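/- arXiv:1209.6019 — 2 statements merged into one kernel-verified Lean document; each statement's English description precedes it below -/
import Mathlib

section
/- For j = i − 1 and j = i (whenever 1 ≤ j ≤ n − 1) and every A ∈ B^{m,i}, one has pr(e_j A) = e_{j+1} pr(A), with the convention pr(0) = 0; in particular e_j A = 0 implies e_{j+1} pr(A) = 0. -/
open Finset

namespace KR

/-- Arrays of integers indexed by (column, row). -/
abbrev Arr := ℕ → ℕ → ℤ

/-- A Dyck path from (1,i) to (i,n). -/
def IsDyck (n i : ℕ) (L : List (ℕ × ℕ)) : Prop :=
  L ≠ [] ∧ L.head? = some (1, i) ∧ L.getLast? = some (i, n) ∧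
    L.Chain' (fun β γ => γ = (β.1, β.2 + 1) ∨ γ = (β.1 + 1, β.2))

/-- Membership in the polytope `B^{m,i}`: nonnegative entries supported on the box
`1 ≤ p ≤ i`, `i ≤ q ≤ n`, with all Dyck path sums bounded by `m`. -/
def InB (n i m : ℕ) (A : Arr) : Prop :=
  (∀ p q, 1 ≤ p → p ≤ i → i ≤ q → q ≤ n → 0 ≤ A p q) ∧
  (∀ p q, ¬(1 ≤ p ∧ p ≤ i ∧ i ≤ q ∧ q ≤ n) → A p q = 0) ∧
  (∀ L, IsDyck n i L → (L.map fun β => A β.1 β.2).sum ≤ (m : ℤ))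

/-- The sum `Σ_{j=1}^{p} a_{j,l−1} + Σ_{j=p}^{i} a_{j,l}` (used for `l > i`). -/
def Fp (i : ℕ) (A : Arr) (l p : ℕ) : ℤ :=
  ∑ j ∈ Icc 1 p, A j (l - 1) + ∑ j ∈ Icc p i, A j l

/-- `p_+^l(A)`: minimal maximizer of `Fp` on `{1,…,i}`. -/
noncomputable def pplus (i : ℕ) (A : Arr) (l : ℕ) : ℕ :=
  sInf {p | p ∈ Icc 1 i ∧ ∀ q ∈ Icc 1 i, Fp i A l q ≤ Fp i A l p}

/-- `q_+^l(A)`: maximal maximizer of `Fp` on `{1,…,i}`. -/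
noncomputable def qplus (i : ℕ) (A : Arr) (l : ℕ) : ℕ :=
  sSup {p | p ∈ Icc 1 i ∧ ∀ q ∈ Icc 1 i, Fp i A l q ≤ Fp i A l p}

/-- The sum `Σ_{j=i}^{p} a_{l,j} + Σ_{j=p}^{n} a_{l+1,j}` (used for `l < i`). -/
def Fm (n i : ℕ) (A : Arr) (l p : ℕ) : ℤ :=
  ∑ j ∈ Icc i p, A l j + ∑ j ∈ Icc p n, A (l + 1) j

/-- `p_−^l(A)`: maximal maximizer of `Fm` on `{i,…,n}`. -/
noncomputable def pminus (n i : ℕ) (A : Arr) (l : ℕ) : ℕ :=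
  sSup {p | p ∈ Icc i n ∧ ∀ q ∈ Icc i n, Fm n i A l q ≤ Fm n i A l p}

/-- `q_−^l(A)`: minimal maximizer of `Fm` on `{i,…,n}`. -/
noncomputable def qminus (n i : ℕ) (A : Arr) (l : ℕ) : ℕ :=
  sInf {p | p ∈ Icc i n ∧ ∀ q ∈ Icc i n, Fm n i A l q ≤ Fm n i A l p}

/-- `φ_l(A)` (depending on the parameter `m` only when `l = i`). -/
noncomputable def phi (n i m : ℕ) (l : ℕ) (A : Arr) : ℤ :=
  if l = i then (m : ℤ) - ∑ j ∈ Icc 1 (i - 1), A j i - ∑ j ∈ Icc i n, A i j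
  else if i < l then
    ∑ j ∈ Icc 1 (pplus i A l), A j (l - 1) - ∑ j ∈ Icc 1 (pplus i A l - 1), A j l
  else
    ∑ j ∈ Icc (pminus n i A l) n, A (l + 1) j - ∑ j ∈ Icc (pminus n i A l + 1) n, A l j

/-- `ε_l(A)` (the parameter `m` is carried along for uniformity; it is not used). -/
noncomputable def eps (n i m : ℕ) (l : ℕ) (A : Arr) : ℤ :=
  if l = i then A i i
  else if i < l then
    ∑ j ∈ Icc (qplus i A l) i, A j l - ∑ j ∈ Icc (qplus i A l + 1) i, A j (l - 1)
  else
    ∑ j ∈ Icc i (qminus n i A l), A l j - ∑ j ∈ Icc i (qminus n i A l - 1), A (l + 1) j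

/-- Update a single entry of an array. -/
def upd (A : Arr) (p q : ℕ) (v : ℤ) : Arr :=
  fun p' q' => if p' = p ∧ q' = q then v else A p' q'

/-- The Kashiwara operator `f_l` (with `none` playing the role of `0`). -/
noncomputable def fop (n i m : ℕ) (l : ℕ) (A : Arr) : Option Arr :=
  if phi n i m l A = 0 then none
  else some <|
    if l = i then upd A i i (A i i + 1)
    else if i < l then
      upd (upd A (pplus i A l) (l - 1) (A (pplus i A l) (l - 1) - 1))
        (pplus i A l) l (A (pplus i A l) l + 1)
    else
      upd (upd A l (pminus n i A l) (A l (pminus n i A l) + 1))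
        (l + 1) (pminus n i A l) (A (l + 1) (pminus n i A l) - 1)

/-- The Kashiwara operator `e_l` (with `none` playing the role of `0`). -/
noncomputable def eop (n i m : ℕ) (l : ℕ) (A : Arr) : Option Arr :=
  if eps n i m l A = 0 then none
  else some <|
    if l = i then upd A i i (A i i - 1)
    else if i < l then
      upd (upd A (qplus i A l) (l - 1) (A (qplus i A l) (l - 1) + 1))
        (qplus i A l) l (A (qplus i A l) l - 1)
    else
      upd (upd A l (qminus n i A l) (A l (qminus n i A l) - 1))
        (l + 1) (qminus n i A l) (A (l + 1) (qminus n i A l) + 1)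

/-- Coefficient of `ω_j` in the simple root `α_r` (column `r` of the Cartan matrix). -/
def cart (j r : ℕ) : ℤ :=
  if r = j then 2 else if r = j + 1 ∨ j = r + 1 then -1 else 0

/-- The weight `wt(A) = mω_i − Σ a_{p,q} α_{p,q}`, expressed in the basis of
fundamental weights: `wtv n i m A j` is the coefficient of `ω_j`. -/
def wtv (n i m : ℕ) (A : Arr) (j : ℕ) : ℤ :=
  (m : ℤ) * (if j = i then 1 else 0) -
    ∑ p ∈ Icc 1 i, ∑ q ∈ Icc i n, A p q * ∑ r ∈ Icc p q, cart j r

/-- The coefficient `c_l(p,q)` of the pairing `⟨α_l^∨, α_{p,q}⟩`. -/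
def clpq (l p q : ℕ) : ℤ :=
  if p = l ∧ q = l then 2
  else if (l = p ∧ p < q) ∨ (p < q ∧ q = l) then 1
  else if l + 1 = p ∨ l = q + 1 then -1
  else 0

/-- The pairing `⟨α_l^∨, wt(A)⟩ = m·δ_{l,i} − Σ_{p,q} a_{p,q}·c_l(p,q)`. -/
def pairing (n i m : ℕ) (l : ℕ) (A : Arr) : ℤ :=
  (m : ℤ) * (if l = i then 1 else 0) -
    ∑ p ∈ Icc 1 i, ∑ q ∈ Icc i n, A p q * clpq l p q

/-! ### The promotion algorithm -/

/-- Columns, indexed by rows `i,…,n`. -/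
abbrev Col := ℕ → ℤ

/-- `Σ_{j=lo}^{p} a_j + Σ_{j=p}^{n} b_j`. -/
def Gc (n lo : ℕ) (a b : Col) (p : ℕ) : ℤ := ∑ j ∈ Icc lo p, a j + ∑ j ∈ Icc p n, b j

/-- `q_−` for two (truncated) columns with rows `lo,…,n`: the minimal maximizer of `Gc`. -/
noncomputable def qmc (n lo : ℕ) (a b : Col) : ℕ :=
  if lo ≤ n then
    max lo (sInf {p | p ∈ Icc lo n ∧ ∀ q ∈ Icc lo n, Gc n lo a b q ≤ Gc n lo a b p})
  else n

/-- `ε` for two (truncated) columns with rows `lo,…,n`. -/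
noncomputable def epsc (n lo : ℕ) (a b : Col) : ℤ :=
  ∑ j ∈ Icc lo (qmc n lo a b), a j - ∑ j ∈ Icc lo (qmc n lo a b - 1), b j

/-- The sequence `l_1 < l_2 < ⋯` of the promotion algorithm:
`l_1 = q_−(a,c)` and `l_{s+1} = q_−((a)^{≥ l_s + 1}, (c)^{≥ l_s + 1})`,
stabilizing at `n`. -/
noncomputable def lfun (n i : ℕ) (a c : Col) : ℕ → ℕ
  | 0 => qmc n i a c
  | s + 1 => qmc n (lfun n i a c s + 1) a c

/-- The set `{l_1, …, l_t}` (with `l_t = n`). -/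
noncomputable def lset (n i : ℕ) (a c : Col) : Finset ℕ := (Finset.range (n + 1)).image (lfun n i a c)

/-- The new column `ĉ` of formula (6.2). -/
noncomputable def hatc (n i : ℕ) (a c : Col) : Col := fun r =>
  if r = n then a n + c n
  else if r ∈ lset n i a c then a r + c r - epsc n (r + 1) a c
  else a r

/-- The output column of one step of the promotion algorithm. -/
noncomputable def prcol (n i : ℕ) (a c : Col) : Col := fun r =>
  if r = i then epsc n i a c
  else if r - 1 ∈ lset n i a c then epsc n r a c
  else c (r - 1)

/-- The running columns of the promotion algorithm: `cseq 0` is the `i`-th column of `A`,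
and `cseq (k+1)` is obtained from the `(i−1−k)`-th column of `A` and `cseq k`. -/
noncomputable def cseq (n i : ℕ) (A : Arr) : ℕ → Col
  | 0 => fun r => A i r
  | k + 1 => hatc n i (fun r => A (i - 1 - k) r) (cseq n i A k)

/-- The `j`-th column of `pr(A)` for `2 ≤ j ≤ i`. -/
noncomputable def prColJ (n i : ℕ) (A : Arr) (j : ℕ) : Col :=
  prcol n i (fun q => A (j - 1) q) (cseq n i A (i - j))

/-- The promotion map `pr` on `B^{m,i}`. -/
noncomputable def prMap (n i m : ℕ) (A : Arr) : Arr := fun p r =>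
  if 1 ≤ p ∧ p ≤ i ∧ i ≤ r ∧ r ≤ n then
    if p = 1 then
      if r = i then
        (m : ℤ) - (∑ j ∈ Icc i n, A i j) - ∑ j ∈ Icc 2 i, prColJ n i A j i
      else
        (∑ j ∈ Icc 1 i, A j (r - 1)) - ∑ j ∈ Icc 2 i, prColJ n i A j r
    else prColJ n i A p r
  else 0

/-- The content `(r_1,…,r_{n+1})` of an array. -/
def cont (n i m : ℕ) (A : Arr) (k : ℕ) : ℤ :=
  if k ≤ i then (m : ℤ) - ∑ q ∈ Icc i n, A k q else ∑ p ∈ Icc 1 i, A p (k - 1)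

/-- The alternating partial sum whose maximum over `p` is `epsc`. -/
def altSum (lo : ℕ) (a c : Col) (p : ℕ) : ℤ := ∑ j ∈ Icc lo p, a j - ∑ j ∈ Ico lo p, c j

lemma altSum_self (lo : ℕ) (a c : Col) : altSum lo a c lo = a lo := by
  simp [altSum]

lemma altSum_of_lt {lo p : ℕ} (h : lo < p) (a c : Col) :
    altSum lo a c p = a lo - c lo + altSum (lo + 1) a c p := by
  unfold altSum
  have : Icc lo p = insert lo (Icc (lo + 1) p) := by ext; simp; omega
  rw [this, Finset.sum_insert (by simp), Finset.sum_eq_sum_Ico_succ_bot h]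
  ring

lemma Gc_eq_altSum {n lo p : ℕ} (h₁ : lo ≤ p) (h₂ : p ≤ n) (a c : Col) :
    Gc n lo a c p = altSum lo a c p + ∑ j ∈ Icc lo n, c j := by
  have h : ∑ j ∈ Icc lo n, c j = ∑ j ∈ Ico lo p, c j + ∑ j ∈ Icc p n, c j := by
    have e : ∀ k, Icc k n = Ico k (n + 1) := fun k => by ext; simp
    rw [e, e, Finset.sum_Ico_consecutive _ h₁ (by omega)]
  unfold Gc altSum
  rw [h]
  ring

lemma qmc_spec {n lo : ℕ} (h : lo ≤ n) (a c : Col) :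
    lo ≤ qmc n lo a c ∧ qmc n lo a c ≤ n ∧
      (∀ p, lo ≤ p → p ≤ n → altSum lo a c p ≤ altSum lo a c (qmc n lo a c)) ∧
      ∀ p, lo ≤ p → p < qmc n lo a c → altSum lo a c p < altSum lo a c (qmc n lo a c) := by
  have hne : {p | p ∈ Icc lo n ∧ ∀ q ∈ Icc lo n, Gc n lo a c q ≤ Gc n lo a c p}.Nonempty :=
    Finset.exists_max_image (Icc lo n) (Gc n lo a c) ⟨lo, by simp [h]⟩
  have hmem := Nat.sInf_mem hne
  have hmin := fun p hp => Nat.notMem_of_lt_sInf (s := {p | p ∈ Icc lo n ∧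
    ∀ q ∈ Icc lo n, Gc n lo a c q ≤ Gc n lo a c p}) (m := p) hp
  have hq : qmc n lo a c =
      sInf {p | p ∈ Icc lo n ∧ ∀ q ∈ Icc lo n, Gc n lo a c q ≤ Gc n lo a c p} := by
    rw [qmc, if_pos h]
    exact max_eq_right (Finset.mem_Icc.1 hmem.1).1
  rw [← hq] at hmem hmin
  obtain ⟨hb, hmax⟩ := hmem
  rw [Finset.mem_Icc] at hb
  refine ⟨hb.1, hb.2, fun p h₁ h₂ => ?_, fun p h₁ h₂ => ?_⟩
  · have := hmax p (by simp [h₁, h₂])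
    rw [Gc_eq_altSum h₁ h₂, Gc_eq_altSum hb.1 hb.2] at this
    linarith
  · by_contra! hlt
    refine hmin p h₂ ⟨by simp; omega, fun r hr => (hmax r hr).trans ?_⟩
    rw [Gc_eq_altSum h₁ (by omega), Gc_eq_altSum hb.1 hb.2]
    linarith

lemma qmc_eq_of {n lo q : ℕ} {a c : Col} (h₁ : lo ≤ q) (h₂ : q ≤ n)
    (hmax : ∀ p, lo ≤ p → p ≤ n → altSum lo a c p ≤ altSum lo a c q)
    (hmin : ∀ p, lo ≤ p → p < q → altSum lo a c p < altSum lo a c q) :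
    qmc n lo a c = q := by
  obtain ⟨g₁, g₂, g₃, g₄⟩ := qmc_spec (h₁.trans h₂) a c
  rcases lt_trichotomy (qmc n lo a c) q with h | h | h
  · exact absurd (hmin _ g₁ h) (g₃ q h₁ h₂).not_gt
  · exact h
  · exact absurd (g₄ _ h₁ h) (hmax _ g₁ g₂).not_gt

lemma epsc_eq_altSum {n lo : ℕ} (hlo : 1 ≤ lo) (h : lo ≤ n) (a c : Col) :
    epsc n lo a c = altSum lo a c (qmc n lo a c) := by
  have := (qmc_spec h a c).1
  have e : Icc lo (qmc n lo a c - 1) = Ico lo (qmc n lo a c) := by ext; simp; omega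
  rw [epsc, altSum, e]

lemma qmc_self (n : ℕ) (a c : Col) : qmc n n a c = n := by
  have := qmc_spec le_rfl a c (n := n)
  omega

lemma epsc_self {n : ℕ} (hn : 1 ≤ n) (a c : Col) : epsc n n a c = a n := by
  rw [epsc_eq_altSum hn le_rfl, qmc_self, altSum_self]

lemma qmc_of_epsc_le {n lo : ℕ} (h : lo < n) {a c : Col}
    (hc : epsc n (lo + 1) a c ≤ c lo) : qmc n lo a c = lo := by
  rw [epsc_eq_altSum (by omega) h] at hc
  refine qmc_eq_of le_rfl h.le (fun p h₁ h₂ => ?_) (fun p h₁ h₂ => by omega)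
  rcases h₁.eq_or_lt with rfl | h₁
  · rfl
  · have := (qmc_spec h a c).2.2.1 p h₁ h₂
    rw [altSum_of_lt h₁, altSum_self]
    linarith

lemma qmc_of_lt_epsc {n lo : ℕ} (h : lo < n) {a c : Col}
    (hc : c lo < epsc n (lo + 1) a c) : qmc n lo a c = qmc n (lo + 1) a c := by
  rw [epsc_eq_altSum (by omega) h] at hc
  obtain ⟨g₁, g₂, g₃, g₄⟩ := qmc_spec (show lo + 1 ≤ n from h) a c
  have key : altSum lo a c lo < altSum lo a c (qmc n (lo + 1) a c) := by
    rw [altSum_self, altSum_of_lt g₁]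
    linarith
  refine qmc_eq_of (by omega) g₂ (fun p h₁ h₂ => ?_) (fun p h₁ h₂ => ?_)
  · rcases h₁.eq_or_lt with rfl | h₁
    · exact key.le
    · have := g₃ p h₁ h₂
      rw [altSum_of_lt h₁, altSum_of_lt g₁]
      linarith
  · rcases h₁.eq_or_lt with rfl | h₁
    · exact key
    · have := g₄ p h₁ h₂
      rw [altSum_of_lt h₁, altSum_of_lt g₁]
      linarith

lemma epsc_of_lt {n lo : ℕ} (hlo : 1 ≤ lo) (h : lo < n) (a c : Col) :
    epsc n lo a c = a lo + max 0 (epsc n (lo + 1) a c - c lo) := by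
  rcases le_or_gt (epsc n (lo + 1) a c) (c lo) with hc | hc
  · rw [epsc_eq_altSum hlo h.le, qmc_of_epsc_le h hc, altSum_self, max_eq_left (by linarith),
      add_zero]
  · rw [epsc_eq_altSum hlo h.le, qmc_of_lt_epsc h hc, altSum_of_lt (qmc_spec h a c).1,
      ← epsc_eq_altSum (by omega) h, max_eq_right (by linarith)]
    ring

lemma epsc_qmc_le {n lo : ℕ} (h : lo ≤ n) (a c : Col) (hq : qmc n lo a c < n) :
    epsc n (qmc n lo a c + 1) a c ≤ c (qmc n lo a c) := by
  induction h using Nat.decreasingInduction with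
  | self => rw [qmc_self] at hq; omega
  | of_succ k hk ih =>
    rcases le_or_gt (epsc n (k + 1) a c) (c k) with hc | hc
    · rwa [qmc_of_epsc_le hk hc]
    · rw [qmc_of_lt_epsc hk hc] at hq ⊢
      exact ih hq

lemma qmc_le_of_epsc_le {n lo r : ℕ} {a c : Col} (h : lo ≤ r) (hrn : r ≤ n)
    (hr : r < n → epsc n (r + 1) a c ≤ c r) : qmc n lo a c ≤ r := by
  rcases hrn.eq_or_lt with rfl | hrn
  · exact (qmc_spec h a c).2.1
  induction h using Nat.decreasingInduction with
  | self => exact (qmc_of_epsc_le hrn (hr hrn)).le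
  | of_succ k hk ih =>
    rcases le_or_gt (epsc n (k + 1) a c) (c k) with hc | hc
    · rw [qmc_of_epsc_le (hk.trans hrn) hc]
      exact hk.le
    · rwa [qmc_of_lt_epsc (hk.trans hrn) hc]

lemma mem_lset_iff {n i : ℕ} (hin : i ≤ n) (a c : Col) (r : ℕ) :
    r ∈ lset n i a c ↔ i ≤ r ∧ r ≤ n ∧ (r < n → epsc n (r + 1) a c ≤ c r) := by
  unfold lset
  rw [Finset.mem_image]
  constructor
  · rintro ⟨s, -, rfl⟩
    induction s with
    | zero => exact ⟨(qmc_spec hin a c).1, (qmc_spec hin a c).2.1, epsc_qmc_le hin a c⟩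
    | succ s ih =>
      rw [lfun]
      rcases Nat.lt_or_ge (lfun n i a c s) n with h | h
      · have := qmc_spec (show lfun n i a c s + 1 ≤ n from h) a c
        exact ⟨by omega, this.2.1, epsc_qmc_le h a c⟩
      · rw [qmc, if_neg (by omega)]
        exact ⟨hin, le_rfl, fun h => absurd h (lt_irrefl n)⟩
  · rintro ⟨h₁, h₂, h₃⟩
    have key : ∀ s, (∃ t ≤ s, lfun n i a c t = r) ∨
        i + s ≤ lfun n i a c s ∧ lfun n i a c s < r := by
      intro s
      induction s with
      | zero =>
        rcases (qmc_le_of_epsc_le h₁ h₂ h₃).eq_or_lt with h | h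
        · exact Or.inl ⟨0, le_rfl, h⟩
        · exact Or.inr ⟨(qmc_spec hin a c).1, h⟩
      | succ s ih =>
        rcases ih with ⟨t, ht, h⟩ | ⟨h, h'⟩
        · exact Or.inl ⟨t, by omega, h⟩
        · have g := (qmc_spec (show lfun n i a c s + 1 ≤ n by omega) a c).1
          rcases (qmc_le_of_epsc_le (show lfun n i a c s + 1 ≤ r from h') h₂ h₃).eq_or_lt
            with h'' | h''
          · exact Or.inl ⟨s + 1, le_rfl, h''⟩
          · exact Or.inr ⟨by rw [lfun]; omega, h''⟩
    rcases key n with ⟨t, ht, h⟩ | ⟨h, h'⟩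
    · exact ⟨t, by simp; omega, h⟩
    · omega

lemma prcol_self (n i : ℕ) (a c : Col) : prcol n i a c i = epsc n i a c := by
  simp [prcol]

lemma prcol_succ {n i r : ℕ} (hir : i ≤ r) (hrn : r < n) (a c : Col) :
    prcol n i a c (r + 1) = min (epsc n (r + 1) a c) (c r) := by
  have h := mem_lset_iff (hir.trans hrn.le) a c r
  rw [prcol, if_neg (by omega), Nat.add_sub_cancel]
  split_ifs with hm
  · exact (min_eq_left ((h.1 hm).2.2 hrn)).symm
  · refine (min_eq_right ?_).symm
    by_contra! hlt
    exact hm (h.2 ⟨hir, hrn.le, fun _ => hlt.le⟩)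

lemma hatc_self (n i : ℕ) (a c : Col) : hatc n i a c n = a n + c n := by
  simp [hatc]

lemma hatc_of_lt {n i r : ℕ} (hir : i ≤ r) (hrn : r < n) (a c : Col) :
    hatc n i a c r = a r + max 0 (c r - epsc n (r + 1) a c) := by
  have h := mem_lset_iff (hir.trans hrn.le) a c r
  rw [hatc, if_neg hrn.ne]
  split_ifs with hm
  · rw [max_eq_right (by linarith [(h.1 hm).2.2 hrn])]
    ring
  · rw [max_eq_left, add_zero]
    by_contra! hlt
    exact hm (h.2 ⟨hir, hrn.le, fun _ => by linarith⟩)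

lemma hatc_of_notMem {n i r : ℕ} (hin : i ≤ n) (hr : ¬(i ≤ r ∧ r ≤ n)) (a c : Col) :
    hatc n i a c r = a r := by
  have hm : r ∉ lset n i a c := fun h => hr (by
    have := (mem_lset_iff hin a c r).1 h
    omega)
  rw [hatc, if_neg (by omega), if_neg hm]

lemma epsc_congr {n lo : ℕ} (hlo : 1 ≤ lo) (h : lo ≤ n) {a a' c c' : Col}
    (ha : ∀ r, lo ≤ r → r ≤ n → a' r = a r) (hc : ∀ r, lo ≤ r → r ≤ n → c' r = c r) :
    epsc n lo a' c' = epsc n lo a c := by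
  induction h using Nat.decreasingInduction with
  | self => rw [epsc_self hlo, epsc_self hlo, ha n le_rfl le_rfl]
  | of_succ k hk ih =>
    rw [epsc_of_lt hlo hk, epsc_of_lt hlo hk, ha k le_rfl hk.le, hc k le_rfl hk.le,
      ih (by omega) (fun r h => ha r (by omega)) (fun r h => hc r (by omega))]

lemma epsc_shift_at_qmc {n i : ℕ} (hi : 1 ≤ i) (hin : i ≤ n) {a c a' c' : Col}
    (ha : ∀ r, a' r = if r = qmc n i a c then a r - 1 else a r)
    (hc : ∀ r, c' r = if r = qmc n i a c then c r + 1 else c r) {r : ℕ}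
    (hir : i ≤ r) (hrn : r ≤ n) :
    epsc n r a' c' = if r ≤ qmc n i a c then epsc n r a c - 1 else epsc n r a c := by
  have hqn := (qmc_spec hin a c).2.1
  induction hrn using Nat.decreasingInduction with
  | self =>
    rw [epsc_self (by omega), epsc_self (by omega), ha]
    split_ifs <;> first | rfl | omega
  | of_succ k hk ih =>
    rw [epsc_of_lt (by omega) hk, epsc_of_lt (by omega) hk, ih (by omega), ha, hc]
    rcases lt_trichotomy k (qmc n i a c) with h | h | h
    · have : c k < epsc n (k + 1) a c := by
        by_contra! h'
        exact absurd (qmc_le_of_epsc_le hir hk.le fun _ => h') (by omega)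
      rw [if_neg h.ne, if_neg h.ne, if_pos (by omega), if_pos h.le]
      omega
    · have := epsc_qmc_le hin a c (by omega)
      rw [← h] at this
      rw [if_pos h, if_pos h, if_neg (by omega), if_pos h.le]
      omega
    · rw [if_neg h.ne', if_neg h.ne', if_neg (by omega), if_neg (by omega)]

lemma prcol_shift_at_qmc {n i : ℕ} (hi : 1 ≤ i) (hin : i ≤ n) {a c a' c' : Col}
    (ha : ∀ r, a' r = if r = qmc n i a c then a r - 1 else a r)
    (hc : ∀ r, c' r = if r = qmc n i a c then c r + 1 else c r) {r : ℕ}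
    (hir : i ≤ r) (hrn : r ≤ n) :
    prcol n i a' c' r = if r = i then prcol n i a c r - 1 else prcol n i a c r := by
  have hq := qmc_spec hin a c
  split_ifs with h
  · subst h
    rw [prcol_self, prcol_self, epsc_shift_at_qmc hi hin ha hc le_rfl hin, if_pos hq.1]
  · obtain ⟨k, rfl⟩ : ∃ k, r = k + 1 := ⟨r - 1, by omega⟩
    rw [prcol_succ (by omega) hrn, prcol_succ (by omega) hrn,
      epsc_shift_at_qmc hi hin ha hc hir hrn, hc]
    rcases lt_trichotomy k (qmc n i a c) with h | h | h
    · have : c k < epsc n (k + 1) a c := by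
        by_contra! h'
        exact absurd (qmc_le_of_epsc_le (show i ≤ k by omega) (by omega) fun _ => h') (by omega)
      rw [if_neg h.ne, if_pos (by omega)]
      omega
    · have := epsc_qmc_le hin a c (by omega)
      rw [← h] at this
      rw [if_pos h, if_neg (by omega)]
      omega
    · rw [if_neg h.ne', if_neg (by omega)]

lemma hatc_shift_at_qmc {n i : ℕ} (hi : 1 ≤ i) (hin : i ≤ n) {a c a' c' : Col}
    (ha : ∀ r, a' r = if r = qmc n i a c then a r - 1 else a r)
    (hc : ∀ r, c' r = if r = qmc n i a c then c r + 1 else c r) :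
    hatc n i a' c' = hatc n i a c := by
  have hq := qmc_spec hin a c
  funext r
  by_cases hr : i ≤ r ∧ r ≤ n
  · obtain ⟨hir, hrn⟩ := hr
    rcases hrn.eq_or_lt with rfl | hrn
    · rw [hatc_self, hatc_self, ha, hc]
      split_ifs
      · ring
      · rfl
    · rw [hatc_of_lt hir hrn, hatc_of_lt hir hrn,
        epsc_shift_at_qmc (r := r + 1) hi hin ha hc (by omega) hrn, ha, hc]
      rcases lt_trichotomy r (qmc n i a c) with h | h | h
      · have : c r < epsc n (r + 1) a c := by
          by_contra! h'
          exact absurd (qmc_le_of_epsc_le hir hrn.le fun _ => h') (by omega)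
        rw [if_neg h.ne, if_neg h.ne, if_pos (by omega)]
        omega
      · have := epsc_qmc_le hin a c (by omega)
        rw [← h] at this
        rw [if_pos h, if_pos h, if_neg (by omega)]
        omega
      · rw [if_neg h.ne', if_neg h.ne', if_neg (by omega)]
  · rw [hatc_of_notMem hin hr, hatc_of_notMem hin hr, ha, if_neg (by omega)]

lemma epsc_lower_first {n i : ℕ} (hi : 1 ≤ i) {a c c' : Col}
    (hc : ∀ r, c' r = if r = i then c r - 1 else c r) {r : ℕ} (hir : i < r) (hrn : r ≤ n) :
    epsc n r a c' = epsc n r a c :=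
  epsc_congr (by omega) hrn (fun _ _ _ => rfl) fun s hs _ => by rw [hc, if_neg (by omega)]

lemma prcol_lower_first {n i : ℕ} (hi : 1 ≤ i) (hin : i < n) {a c c' : Col}
    (hc : ∀ r, c' r = if r = i then c r - 1 else c r) {r : ℕ} (hir : i ≤ r) (hrn : r ≤ n) :
    prcol n i a c' r = prcol n i a c r + if c i ≤ epsc n (i + 1) a c then
      (if r = i then 1 else if r = i + 1 then -1 else 0) else 0 := by
  rcases hir.eq_or_lt with rfl | hir
  · rw [prcol_self, prcol_self, epsc_of_lt hi hin, epsc_of_lt hi hin,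
      epsc_lower_first (r := i + 1) hi hc (by omega) hin, hc, if_pos rfl, if_pos rfl]
    split_ifs <;> omega
  · obtain ⟨k, rfl⟩ : ∃ k, r = k + 1 := ⟨r - 1, by omega⟩
    rw [prcol_succ (by omega) hrn, prcol_succ (by omega) hrn,
      epsc_lower_first hi hc (by omega) hrn, hc, if_neg (show k + 1 ≠ i by omega)]
    rcases eq_or_ne k i with rfl | h
    · rw [if_pos rfl, if_pos rfl]
      split_ifs <;> omega
    · rw [if_neg h, if_neg (show k + 1 ≠ i + 1 by omega), ite_self, add_zero]

lemma hatc_lower_first {n i : ℕ} (hi : 1 ≤ i) (hin : i < n) {a c c' : Col}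
    (hc : ∀ r, c' r = if r = i then c r - 1 else c r) (r : ℕ) :
    hatc n i a c' r = if r = i ∧ epsc n (i + 1) a c < c i then hatc n i a c r - 1
      else hatc n i a c r := by
  by_cases hr : i ≤ r ∧ r ≤ n
  · obtain ⟨hir, hrn⟩ := hr
    rcases hrn.eq_or_lt with rfl | hrn
    · rw [hatc_self, hatc_self, hc, if_neg hin.ne', if_neg (by omega)]
    · rw [hatc_of_lt hir hrn, hatc_of_lt hir hrn,
        epsc_lower_first (r := r + 1) hi hc (by omega) hrn, hc]
      rcases eq_or_ne r i with rfl | h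
      · rw [if_pos rfl]
        split_ifs <;> omega
      · rw [if_neg h, if_neg (by tauto)]
  · rw [hatc_of_notMem hin.le hr, hatc_of_notMem hin.le hr, if_neg (by omega)]

/-- The column that the promotion algorithm combines with column `j - 1` of `A`. -/
noncomputable def runCol (n i : ℕ) (A : Arr) (j : ℕ) : Col := cseq n i A (i - j)

lemma runCol_self (n i : ℕ) (A : Arr) : runCol n i A i = A i := by
  rw [runCol, Nat.sub_self, cseq]

lemma runCol_pred {n i j : ℕ} (hj : 1 ≤ j) (hji : j < i) (A : Arr) :
    runCol n i A j = hatc n i (A j) (runCol n i A (j + 1)) := by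
  rw [runCol, show i - j = (i - (j + 1)) + 1 by omega, cseq,
    show i - 1 - (i - (j + 1)) = j by omega]
  rfl

lemma prColJ_eq (n i : ℕ) (A : Arr) (j : ℕ) :
    prColJ n i A j = prcol n i (A (j - 1)) (runCol n i A j) := rfl

lemma Icc_eq_insert {a b : ℕ} (h : a ≤ b) : Icc a b = insert a (Icc (a + 1) b) := by
  ext; simp; omega

lemma sum_Icc_eq_add {a b : ℕ} (h : a ≤ b) (f : ℕ → ℤ) :
    ∑ j ∈ Icc a b, f j = f a + ∑ j ∈ Icc (a + 1) b, f j := by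
  rw [Icc_eq_insert h, Finset.sum_insert (by simp)]

lemma sum_Icc_congr {a b : ℕ} {f g : ℕ → ℤ} (h : ∀ j, a ≤ j → j ≤ b → f j = g j) :
    ∑ j ∈ Icc a b, f j = ∑ j ∈ Icc a b, g j :=
  Finset.sum_congr rfl fun j hj => h j (Finset.mem_Icc.1 hj).1 (Finset.mem_Icc.1 hj).2

lemma sum_Icc_add_ite {a b : ℕ} {f g : ℕ → ℤ} {q : ℕ} {d : ℤ}
    (h : ∀ j, a ≤ j → j ≤ b → g j = f j + if j = q then d else 0) :
    ∑ j ∈ Icc a b, g j = ∑ j ∈ Icc a b, f j + if a ≤ q ∧ q ≤ b then d else 0 := by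
  rw [sum_Icc_congr h, Finset.sum_add_distrib, Finset.sum_ite_eq']
  simp

lemma prMap_of_two_le {n i m p r : ℕ} (hp : 2 ≤ p) (hpi : p ≤ i) (hir : i ≤ r) (hrn : r ≤ n)
    (A : Arr) : prMap n i m A p r = prColJ n i A p r := by
  rw [prMap, if_pos ⟨by omega, hpi, hir, hrn⟩, if_neg (by omega)]

lemma prMap_one_first {n i m : ℕ} (hi : 1 ≤ i) (hin : i ≤ n) (A : Arr) :
    prMap n i m A 1 i = m - ∑ j ∈ Icc i n, A i j - ∑ j ∈ Icc 2 i, prColJ n i A j i := by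
  rw [prMap, if_pos ⟨le_rfl, hi, le_rfl, hin⟩, if_pos rfl, if_pos rfl]

lemma prMap_one_of_lt {n i m r : ℕ} (hi : 1 ≤ i) (hir : i < r) (hrn : r ≤ n) (A : Arr) :
    prMap n i m A 1 r =
      ∑ j ∈ Icc 1 i, A j (r - 1) - ∑ j ∈ Icc 2 i, prColJ n i A j r := by
  rw [prMap, if_pos ⟨le_rfl, hi, hir.le, hrn⟩, if_pos rfl, if_neg hir.ne']

lemma prMap_of_outside {n i m p r : ℕ} (h : ¬(1 ≤ p ∧ p ≤ i ∧ i ≤ r ∧ r ≤ n)) (A : Arr) :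
    prMap n i m A p r = 0 := if_neg h

lemma prMap_shift_at_qmc {n i : ℕ} (m : ℕ) (hi : 2 ≤ i) (hin : i ≤ n) {A A' : Arr} {q : ℕ}
    (hq : q = qmc n i (A (i - 1)) (A i))
    (h₁ : ∀ r, A' (i - 1) r = if r = q then A (i - 1) r - 1 else A (i - 1) r)
    (h₂ : ∀ r, A' i r = if r = q then A i r + 1 else A i r)
    (h₃ : ∀ p, p < i - 1 → A' p = A p) :
    prMap n i m A' = upd (prMap n i m A) i i (prMap n i m A i i - 1) := by
  obtain ⟨l, rfl⟩ : ∃ l, i = l + 1 := ⟨i - 1, by omega⟩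
  rw [Nat.add_sub_cancel] at hq h₁ h₃
  subst hq
  have hqs := qmc_spec hin (A l) (A (l + 1))
  have hrun : ∀ j, 1 ≤ j → j ≤ l → runCol n (l + 1) A' j = runCol n (l + 1) A j := by
    intro j hj hjl
    induction hjl using Nat.decreasingInduction with
    | self =>
      rw [runCol_pred hj (by omega), runCol_pred hj (by omega), runCol_self, runCol_self]
      exact hatc_shift_at_qmc (by omega) hin h₁ h₂
    | of_succ k hk ih =>
      rw [runCol_pred hj (by omega), runCol_pred hj (by omega), ih (by omega), h₃ k hk]
  have hcol : ∀ r, l + 1 ≤ r → r ≤ n → ∀ j, 2 ≤ j → j ≤ l + 1 →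
      prColJ n (l + 1) A' j r = prColJ n (l + 1) A j r +
        if j = l + 1 then (if r = l + 1 then -1 else 0) else 0 := by
    intro r hr hrn j hj hjl
    rw [prColJ_eq, prColJ_eq]
    rcases eq_or_ne j (l + 1) with rfl | h
    · rw [runCol_self, runCol_self, Nat.add_sub_cancel,
        prcol_shift_at_qmc (by omega) hin h₁ h₂ hr hrn, if_pos rfl]
      split_ifs <;> ring
    · rw [hrun j (by omega) (by omega), h₃ _ (by omega), if_neg h, add_zero]
  funext p r
  rw [upd]
  by_cases hbox : 1 ≤ p ∧ p ≤ l + 1 ∧ l + 1 ≤ r ∧ r ≤ n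
  · obtain ⟨hp, hpl, hr, hrn⟩ := hbox
    rcases hp.eq_or_lt with rfl | hp
    · rw [if_neg (by omega)]
      rcases hr.eq_or_lt with rfl | hr
      · rw [prMap_one_first (by omega) hin, prMap_one_first (by omega) hin,
          sum_Icc_add_ite (hcol _ le_rfl hin),
          sum_Icc_add_ite (f := A (l + 1)) (q := qmc n (l + 1) (A l) (A (l + 1))) (d := 1)
            fun j _ _ => by rw [h₂]; split_ifs <;> ring,
          if_pos ⟨hqs.1, hqs.2.1⟩, if_pos ⟨hi, le_rfl⟩, if_pos rfl]
        ring
      · have hsum : ∑ j ∈ Icc 1 (l + 1), A' j (r - 1) = ∑ j ∈ Icc 1 (l + 1), A j (r - 1) := by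
          rw [Finset.sum_Icc_succ_top (by omega), Finset.sum_Icc_succ_top (by omega),
            sum_Icc_add_ite (f := fun j => A j (r - 1)) (q := l)
              (d := if r - 1 = qmc n (l + 1) (A l) (A (l + 1)) then -1 else 0)
              fun j _ hj => ?_, h₂, if_pos (by omega)]
          · split_ifs <;> ring
          · rcases hj.eq_or_lt with rfl | hj
            · rw [h₁, if_pos rfl]
              split_ifs <;> ring
            · rw [h₃ j hj, if_neg hj.ne, add_zero]
        rw [prMap_one_of_lt (by omega) hr hrn, prMap_one_of_lt (by omega) hr hrn, hsum,
          sum_Icc_add_ite (hcol r hr.le hrn), if_neg hr.ne', ite_self, add_zero]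
    · rw [prMap_of_two_le hp hpl hr hrn, prMap_of_two_le hi le_rfl le_rfl hin,
        hcol r hr hrn p hp hpl]
      by_cases h : p = l + 1 ∧ r = l + 1
      · rw [if_pos h, if_pos h.1, if_pos h.2, h.1, h.2]
        ring
      · rw [if_neg h]
        rw [prMap_of_two_le hp hpl hr hrn]
        split_ifs <;> omega
  · rw [prMap_of_outside hbox, prMap_of_outside hbox, if_neg (by omega)]

/-- The local relations between consecutive rows of a promotion array force the
maximal position of the alternating sums to be `q`, with maximal value `x i`. -/
lemma altSum_rows_spec {i q : ℕ} {x y u v : ℕ → ℤ} (hq : 1 ≤ q) (hqi : q ≤ i)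
    (hv₁ : v 1 = x 1) (hv : ∀ j, 2 ≤ j → j ≤ i → v j = min (x j) (y j))
    (hx : ∀ j, 2 ≤ j → j ≤ i → x (j - 1) - u j = x j - y j)
    (hgt : ∀ j, q < j → j ≤ i → y j < x j) (hle : 2 ≤ q → x q ≤ y q) :
    ∑ j ∈ Icc q i, v j - ∑ j ∈ Icc (q + 1) i, u j = x i ∧
      ∀ p, 1 ≤ p → p ≤ i → ∑ j ∈ Icc p i, v j - ∑ j ∈ Icc (p + 1) i, u j ≤ x i ∧
        (q < p → ∑ j ∈ Icc p i, v j - ∑ j ∈ Icc (p + 1) i, u j < x i) := by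
  have key : ∀ p, 1 ≤ p → p ≤ i →
      ∑ j ∈ Icc (p + 1) i, v j - ∑ j ∈ Icc (p + 1) i, u j + x p ≤ x i ∧
      (q ≤ p → ∑ j ∈ Icc (p + 1) i, v j - ∑ j ∈ Icc (p + 1) i, u j + x p = x i) := by
    intro p hp hpi
    induction hpi using Nat.decreasingInduction with
    | self => simp
    | of_succ k hk ih =>
      obtain ⟨ih₁, ih₂⟩ := ih (by omega)
      have hv' := hv (k + 1) (by omega) hk
      have hx' := hx (k + 1) (by omega) hk
      rw [Nat.add_sub_cancel] at hx'
      rw [sum_Icc_eq_add (a := k + 1) hk v, sum_Icc_eq_add (a := k + 1) hk u]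
      refine ⟨by omega, fun hqk => ?_⟩
      have := hgt (k + 1) (by omega) hk
      have := ih₂ (by omega)
      omega
  have hv_le : ∀ p, 1 ≤ p → p ≤ i → v p ≤ x p := by
    intro p hp hpi
    rcases hp.eq_or_lt with rfl | hp
    · exact hv₁.le
    · exact (hv p hp hpi).le.trans (min_le_left _ _)
  refine ⟨?_, fun p hp hpi => ?_⟩
  · have hvq : v q = x q := by
      rcases hq.eq_or_lt with rfl | hq
      · exact hv₁
      · rw [hv q hq hqi, min_eq_left (hle hq)]
    have := (key q hq hqi).2 le_rfl
    rw [sum_Icc_eq_add hqi v]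
    linarith
  · have h₁ := (key p hp hpi).1
    have h₂ := hv_le p hp hpi
    rw [sum_Icc_eq_add hpi v]
    refine ⟨by linarith, fun hqp => ?_⟩
    have h₃ := hv p (by omega) hpi
    have h₄ := hgt p hqp hpi
    rw [min_eq_right h₄.le] at h₃
    linarith

lemma Fp_eq {i l p : ℕ} (hp : p ≤ i) (A : Arr) :
    Fp i A l p = ∑ j ∈ Icc 1 i, A j (l - 1) +
      (∑ j ∈ Icc p i, A j l - ∑ j ∈ Icc (p + 1) i, A j (l - 1)) := by
  have h : ∑ j ∈ Icc 1 i, A j (l - 1) =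
      ∑ j ∈ Icc 1 p, A j (l - 1) + ∑ j ∈ Icc (p + 1) i, A j (l - 1) := by
    rw [← Finset.sum_union]
    · congr 1
      ext; simp; omega
    · rw [Finset.disjoint_left]
      intro x
      simp only [Finset.mem_Icc]
      omega
  rw [Fp, h]
  ring

lemma qplus_eq_of {i l q : ℕ} {A : Arr} (hq : 1 ≤ q) (hqi : q ≤ i) {M : ℤ}
    (hqM : ∑ j ∈ Icc q i, A j l - ∑ j ∈ Icc (q + 1) i, A j (l - 1) = M)
    (h : ∀ p, 1 ≤ p → p ≤ i →
      ∑ j ∈ Icc p i, A j l - ∑ j ∈ Icc (p + 1) i, A j (l - 1) ≤ M ∧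
        (q < p → ∑ j ∈ Icc p i, A j l - ∑ j ∈ Icc (p + 1) i, A j (l - 1) < M)) :
    qplus i A l = q := by
  refine IsGreatest.csSup_eq ⟨⟨by simp [hq, hqi], fun p hp => ?_⟩, fun p hp => ?_⟩
  · rw [Finset.mem_Icc] at hp
    rw [Fp_eq hp.2, Fp_eq hqi, hqM]
    linarith [(h p hp.1 hp.2).1]
  · obtain ⟨hp, hmax⟩ := hp
    rw [Finset.mem_Icc] at hp
    by_contra! hlt
    have := hmax q (by simp [hq, hqi])
    rw [Fp_eq hp.2, Fp_eq hqi, hqM] at this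
    linarith [(h p hp.1 hp.2).2 hlt]

lemma runCol_sub_prColJ {n i j : ℕ} (hi : 1 ≤ i) (hin : i < n) (hj : 2 ≤ j) (hji : j ≤ i)
    (A : Arr) :
    runCol n i A (j - 1) i - prColJ n i A j i =
      runCol n i A j i - epsc n (i + 1) (A (j - 1)) (runCol n i A j) := by
  rw [runCol_pred (by omega) (by omega), Nat.sub_add_cancel (by omega), prColJ_eq, prcol_self,
    epsc_of_lt hi hin, hatc_of_lt le_rfl hin]
  omega

lemma prMap_one_second {n i : ℕ} (m : ℕ) (hi : 1 ≤ i) (hin : i < n) (A : Arr) :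
    prMap n i m A 1 (i + 1) = runCol n i A 1 i := by
  have key : ∀ p, 1 ≤ p → p ≤ i → ∑ j ∈ Icc p i, A j i -
      ∑ j ∈ Icc (p + 1) i, prColJ n i A j (i + 1) = runCol n i A p i := by
    intro p hp hpi
    induction hpi using Nat.decreasingInduction with
    | self => simp [runCol_self]
    | of_succ k hk ih =>
      have := ih (by omega)
      rw [sum_Icc_eq_add hk.le, sum_Icc_eq_add (a := k + 1) hk fun j => prColJ n i A j (i + 1),
        runCol_pred hp hk, prColJ_eq,
        Nat.add_sub_cancel, prcol_succ le_rfl hin, hatc_of_lt le_rfl hin]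
      omega
  rw [prMap_one_of_lt (r := i + 1) hi (by omega) hin, Nat.add_sub_cancel]
  exact key 1 le_rfl hi

lemma exists_pivot {n i : ℕ} (hi : 1 ≤ i) (A : Arr) :
    ∃ q, 1 ≤ q ∧ q ≤ i ∧
      (∀ j, q < j → j ≤ i →
        epsc n (i + 1) (A (j - 1)) (runCol n i A j) < runCol n i A j i) ∧
      (2 ≤ q → runCol n i A q i ≤ epsc n (i + 1) (A (q - 1)) (runCol n i A q)) := by
  classical
  let P : ℕ → Prop := fun q => 1 ≤ q ∧
    (2 ≤ q → runCol n i A q i ≤ epsc n (i + 1) (A (q - 1)) (runCol n i A q))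
  have hP : P 1 := ⟨le_rfl, fun h => by omega⟩
  have hs := Nat.findGreatest_spec (P := P) hi hP
  refine ⟨Nat.findGreatest P i, hs.1, Nat.findGreatest_le i, fun j hj hji => ?_, hs.2⟩
  by_contra! h
  exact Nat.findGreatest_is_greatest hj hji ⟨by omega, fun _ => h⟩

lemma runCol_lower_first {n i q : ℕ} (hi : 1 ≤ i) (hin : i < n) {A A' : Arr} (hq : 1 ≤ q)
    (hqi : q ≤ i) (hgt : ∀ j, q < j → j ≤ i →
      epsc n (i + 1) (A (j - 1)) (runCol n i A j) < runCol n i A j i)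
    (hle : 2 ≤ q → runCol n i A q i ≤ epsc n (i + 1) (A (q - 1)) (runCol n i A q))
    (h₁ : ∀ r, A' i r = if r = i then A i r - 1 else A i r) (h₂ : ∀ p, p < i → A' p = A p)
    {j : ℕ} (hj : 1 ≤ j) (hji : j ≤ i) (r : ℕ) :
    runCol n i A' j r =
      if q ≤ j ∧ r = i then runCol n i A j r - 1 else runCol n i A j r := by
  induction hji using Nat.decreasingInduction generalizing r with
  | self =>
    rw [runCol_self, runCol_self, h₁]
    simp [hqi]
  | of_succ k hk ih =>
    rw [runCol_pred hj hk, runCol_pred hj hk, h₂ k hk]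
    rcases Nat.lt_or_ge k q with h | h
    · rw [if_neg (by omega)]
      rcases Nat.lt_or_ge (k + 1) q with h' | h'
      · have : runCol n i A' (k + 1) = runCol n i A (k + 1) := by
          funext s
          rw [ih (by omega), if_neg (by omega)]
        rw [this]
      · obtain rfl : q = k + 1 := by omega
        have := hle (by omega)
        rw [Nat.add_sub_cancel] at this
        rw [hatc_lower_first hi hin (c := runCol n i A (k + 1))
          (fun s => by rw [ih (by omega)]; simp), if_neg]
        omega
    · have := hgt (k + 1) (by omega) hk
      rw [Nat.add_sub_cancel] at this
      rw [hatc_lower_first hi hin (c := runCol n i A (k + 1))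
        (fun s => by rw [ih (by omega)]; simp [show q ≤ k + 1 by omega])]
      simp [this, h]

lemma prMap_lower_first {n i q : ℕ} (m : ℕ) (hi : 1 ≤ i) (hin : i < n) {A A' : Arr}
    (hq : 1 ≤ q) (hqi : q ≤ i) (hgt : ∀ j, q < j → j ≤ i →
      epsc n (i + 1) (A (j - 1)) (runCol n i A j) < runCol n i A j i)
    (hle : 2 ≤ q → runCol n i A q i ≤ epsc n (i + 1) (A (q - 1)) (runCol n i A q))
    (h₁ : ∀ r, A' i r = if r = i then A i r - 1 else A i r) (h₂ : ∀ p, p < i → A' p = A p)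
    (p r : ℕ) :
    prMap n i m A' p r = prMap n i m A p r +
      if p = q then (if r = i then 1 else if r = i + 1 then -1 else 0) else 0 := by
  have hcol : ∀ r, i ≤ r → r ≤ n → ∀ j, 2 ≤ j → j ≤ i →
      prColJ n i A' j r = prColJ n i A j r +
        if j = q then (if r = i then 1 else if r = i + 1 then -1 else 0) else 0 := by
    intro r hr hrn j hj hji
    have hrun := fun s => runCol_lower_first hi hin hq hqi hgt hle h₁ h₂
      (show 1 ≤ j by omega) hji s
    rw [prColJ_eq, prColJ_eq, h₂ (j - 1) (by omega)]
    rcases Nat.lt_or_ge j q with h | h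
    · have : runCol n i A' j = runCol n i A j := by
        funext s
        rw [hrun, if_neg (by omega)]
      rw [this, if_neg h.ne, add_zero]
    · rw [prcol_lower_first hi hin (c := runCol n i A j) (fun s => by rw [hrun]; simp [h]) hr hrn]
      rcases h.eq_or_lt with rfl | h
      · rw [if_pos (hle hj), if_pos rfl]
      · rw [if_neg (hgt j h hji).not_ge, if_neg h.ne']
  by_cases hbox : 1 ≤ p ∧ p ≤ i ∧ i ≤ r ∧ r ≤ n
  · obtain ⟨hp, hpi, hr, hrn⟩ := hbox
    rcases hp.eq_or_lt with rfl | hp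
    · rcases hr.eq_or_lt with rfl | hr
      · rw [prMap_one_first hi hrn, prMap_one_first hi hrn, sum_Icc_add_ite (hcol i le_rfl hrn),
          sum_Icc_add_ite (f := A i) (q := i) (d := -1)
            fun j _ _ => by rw [h₁]; split_ifs <;> ring]
        split_ifs <;> omega
      · rw [prMap_one_of_lt hi hr hrn, prMap_one_of_lt hi hr hrn,
          sum_Icc_add_ite (hcol r hr.le hrn),
          sum_Icc_add_ite (f := fun j => A j (r - 1)) (q := i)
            (d := if r = i + 1 then -1 else 0) fun j _ hj => ?_]
        · split_ifs <;> omega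
        · rcases hj.eq_or_lt with rfl | hj
          · rw [h₁]
            split_ifs <;> omega
          · rw [h₂ j hj, if_neg hj.ne, add_zero]
    · rw [prMap_of_two_le hp hpi hr hrn, prMap_of_two_le hp hpi hr hrn, hcol r hr hrn p hp hpi]
  · rw [prMap_of_outside hbox, prMap_of_outside hbox]
    split_ifs <;> omega

lemma qplus_prMap {n i q : ℕ} (m : ℕ) (hi : 1 ≤ i) (hin : i < n) {A : Arr}
    (hq : 1 ≤ q) (hqi : q ≤ i) (hgt : ∀ j, q < j → j ≤ i →
      epsc n (i + 1) (A (j - 1)) (runCol n i A j) < runCol n i A j i)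
    (hle : 2 ≤ q → runCol n i A q i ≤ epsc n (i + 1) (A (q - 1)) (runCol n i A q)) :
    qplus i (prMap n i m A) (i + 1) = q ∧ eps n i m (i + 1) (prMap n i m A) = A i i := by
  obtain ⟨h₁, h₂⟩ := altSum_rows_spec (x := fun j => runCol n i A j i)
    (y := fun j => epsc n (i + 1) (A (j - 1)) (runCol n i A j))
    (u := fun j => prMap n i m A j i) (v := fun j => prMap n i m A j (i + 1)) hq hqi
    (prMap_one_second m hi hin A)
    (fun j hj hji => by
      rw [prMap_of_two_le hj hji (by omega) hin, prColJ_eq, prcol_succ le_rfl hin, min_comm])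
    (fun j hj hji => by
      rw [prMap_of_two_le hj hji le_rfl hin.le]
      exact runCol_sub_prColJ hi hin hj hji A)
    hgt hle
  have hqp : qplus i (prMap n i m A) (i + 1) = q := qplus_eq_of hq hqi h₁ h₂
  refine ⟨hqp, ?_⟩
  rw [eps, if_neg (by omega), if_pos (by omega), hqp, Nat.add_sub_cancel, h₁, runCol_self]

lemma qminus_eq_qmc {n i : ℕ} (hi : 1 ≤ i) (hin : i ≤ n) (A : Arr) :
    qminus n i A (i - 1) = qmc n i (A (i - 1)) (A i) := by
  have hs : qminus n i A (i - 1) = sInf {p | p ∈ Icc i n ∧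
      ∀ q ∈ Icc i n, Gc n i (A (i - 1)) (A i) q ≤ Gc n i (A (i - 1)) (A i) p} := by
    simp only [qminus, Fm, Gc, Nat.sub_add_cancel hi]
  have hne : {p | p ∈ Icc i n ∧ ∀ q ∈ Icc i n,
      Gc n i (A (i - 1)) (A i) q ≤ Gc n i (A (i - 1)) (A i) p}.Nonempty :=
    Finset.exists_max_image (Icc i n) _ ⟨i, by simp [hin]⟩
  rw [qmc, if_pos hin, hs, max_eq_right (Finset.mem_Icc.1 (Nat.sInf_mem hne).1).1]

/-- For `j = i − 1` and `j = i` (whenever `1 ≤ j ≤ n − 1`),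
`pr(e_j A) = e_{j+1} pr(A)` (with `pr(0) = 0`). -/
theorem stmt15 (n i m : ℕ) (hi : 2 ≤ i) (hin : i ≤ n) (j : ℕ)
    (hj : j = i - 1 ∨ j = i) (hj1 : 1 ≤ j) (hjn : j ≤ n - 1)
    (A : Arr) (hA : InB n i m A) :
    Option.map (prMap n i m) (eop n i m j A) = eop n i m (j + 1) (prMap n i m A) := by
  rcases hj with rfl | rfl
  · have hq := qminus_eq_qmc (show 1 ≤ i by omega) hin A
    have hsucc : i - 1 + 1 = i := by omega
    have heps : eps n i m (i - 1) A = prMap n i m A i i := by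
      rw [prMap_of_two_le hi le_rfl le_rfl hin, prColJ_eq, prcol_self, runCol_self, eps,
        if_neg (by omega), if_neg (by omega), hq, epsc, hsucc]
    rw [hsucc, eop, eop, heps, eps, if_pos rfl]
    by_cases h0 : prMap n i m A i i = 0
    · rw [if_pos h0, if_pos h0, Option.map_none]
    · rw [if_neg h0, if_neg h0, Option.map_some, if_neg (by omega), if_neg (by omega), if_pos rfl, hsucc,
        prMap_shift_at_qmc m hi hin hq]
      · intro r
        simp only [upd]
        split_ifs <;> grind
      · intro r
        simp only [upd]
        split_ifs <;> grind
      · intro p hp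
        funext r
        simp only [upd]
        rw [if_neg (by omega), if_neg (by omega)]
  · obtain ⟨q, hq, hqj, hgt, hle⟩ := exists_pivot (n := n) hj1 A
    have hjn' : j < n := by omega
    obtain ⟨hqp, heps⟩ := qplus_prMap m hj1 hjn' hq hqj hgt hle
    rw [eop, eop, heps, eps, if_pos rfl]
    by_cases h0 : A j j = 0
    · rw [if_pos h0, if_pos h0, Option.map_none]
    · rw [if_neg h0, if_neg h0, Option.map_some, if_pos rfl, if_neg (by omega), if_pos (by omega), hqp,
        Nat.add_sub_cancel]
      congr 1
      funext p r
      rw [prMap_lower_first m hj1 hjn' hq hqj hgt hle]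
      · simp only [upd]
        split_ifs <;> grind
      · intro r
        simp only [upd]
        split_ifs <;> grind
      · intro p hp
        funext r
        simp only [upd]
        rw [if_neg (by omega)]

end KR
end

section
/- The promotion map intertwines the Kashiwara raising operators with a shift of index: for every j ∈ {1,…,n−1} and every A ∈ B^{m,i}, pr(e_j A) = e_{j+1} pr(A), with the convention pr(0) = 0. -/
open Finset

namespace KR

theorem Gc_succ_left (n lo p : ℕ) (a b : Col) (h : lo < p) :
    Gc n lo a b p = a lo + Gc n (lo + 1) a b p := by
  unfold Gc
  rw [← Finset.add_sum_Ioc_eq_sum_Icc (by omega : lo ≤ p)]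
  have : Ioc lo p = Icc (lo + 1) p := by ext; simp
  rw [this]; ring

theorem Gc_succ (t s p : ℕ) (a b : Col) (h1 : s ≤ p) (h2 : p < t) :
    Gc t s a b (p + 1) = Gc t s a b p + a (p + 1) - b p := by
  unfold Gc
  rw [Finset.sum_Icc_succ_top (by omega), ← Finset.add_sum_Ioc_eq_sum_Icc h2.le]
  have : Ioc p t = Icc (p + 1) t := by ext; simp
  rw [this]; ring

theorem Gc_self_left (t s : ℕ) (a b : Col) :
    Gc t s a b s = a s + ∑ j ∈ Icc s t, b j := by
  simp [Gc]

theorem sum_Icc_sub_top (f : ℕ → ℤ) (n : ℕ) : ∀ k lo, lo + k = n + 1 →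
    ∑ j ∈ Icc lo n, (f j - f (j + 1)) = f lo - f (n + 1)
  | 0, lo, h => by
    have : Icc lo n = ∅ := by ext; simp; omega
    rw [this]; obtain rfl : lo = n + 1 := by omega
    simp
  | k + 1, lo, h => by
    rw [← Finset.add_sum_Ioc_eq_sum_Icc (by omega : lo ≤ n)]
    have : Ioc lo n = Icc (lo + 1) n := by ext; simp
    rw [this, sum_Icc_sub_top f n k (lo + 1) (by omega)]; ring

/-- The minimal maximizer of `Gc`, characterised by its defining inequalities. -/
theorem qmc_eq (n lo q : ℕ) (a b : Col) (h1 : lo ≤ q) (h2 : q ≤ n)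
    (hle : ∀ p, lo ≤ p → p ≤ n → Gc n lo a b p ≤ Gc n lo a b q)
    (hlt : ∀ p, lo ≤ p → p < q → Gc n lo a b p < Gc n lo a b q) :
    qmc n lo a b = q := by
  have hmem : q ∈ {p | p ∈ Icc lo n ∧ ∀ q ∈ Icc lo n, Gc n lo a b q ≤ Gc n lo a b p} := by
    refine ⟨by simp; omega, fun p hp => ?_⟩
    rw [mem_Icc] at hp; exact hle p hp.1 hp.2
  have hs := Nat.sInf_mem ⟨q, hmem⟩
  have hs' := Nat.sInf_le hmem
  unfold qmc
  rw [if_pos (by omega)]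
  set x := sInf {p | p ∈ Icc lo n ∧ ∀ q ∈ Icc lo n, Gc n lo a b q ≤ Gc n lo a b p} with hx
  obtain ⟨hs1, hs2⟩ := hs
  rw [mem_Icc] at hs1
  rcases hs'.lt_or_eq with h | h
  · have := hlt x hs1.1 h
    have := hs2 q (by simp; omega)
    omega
  · omega

theorem epsc_eq (n lo : ℕ) (a b : Col) (h0 : 1 ≤ lo) (h1 : lo ≤ qmc n lo a b)
    (h2 : qmc n lo a b ≤ n) :
    epsc n lo a b = Gc n lo a b (qmc n lo a b) - ∑ j ∈ Icc lo n, b j := by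
  have key : ∀ q, lo ≤ q → q ≤ n → ∑ j ∈ Icc lo (q - 1), b j + ∑ j ∈ Icc q n, b j =
      ∑ j ∈ Icc lo n, b j := by
    intro q hq hq'
    rw [← Finset.sum_union]
    · congr 1; ext; simp; omega
    · rw [Finset.disjoint_left]; intro x; simp; omega
  have := key _ h1 h2
  unfold epsc Gc; omega

/-- Two columns `a`, `c` written through the last passage values `U`, `V`. -/
structure ColData (n i : ℕ) (U V : ℕ → ℤ) (a c : Col) : Prop where
  ha : ∀ r, i ≤ r → r ≤ n → a r = U r - max (V r) (U (r + 1))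
  hc : ∀ r, i ≤ r → r ≤ n → c r = V r - V (r + 1)
  hU : U (n + 1) = 0
  hV : V (n + 1) = 0
  hVn : 0 ≤ V n
  hi : 1 ≤ i
  hin : i ≤ n

namespace ColData

variable {n i : ℕ} {U V : ℕ → ℤ} {a c : Col}

theorem sum_c (h : ColData n i U V a c) (lo : ℕ) (hlo : i ≤ lo) (hn : lo ≤ n) :
    ∑ j ∈ Icc lo n, c j = V lo := by
  have := sum_Icc_sub_top V n (n + 1 - lo) lo (by omega)
  rw [h.hV] at this
  rw [← sub_zero (V lo), ← this]
  refine Finset.sum_congr rfl fun x hx => ?_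
  rw [mem_Icc] at hx
  exact h.hc x (by omega) hx.2

theorem Gc_le (h : ColData n i U V a c) : ∀ k lo p, p = lo + k → i ≤ lo → p ≤ n →
    Gc n lo a c p ≤ U lo
  | 0, lo, p, hp, hlo, hn => by
    obtain rfl : p = lo := by omega
    rw [Gc_self_left, h.sum_c _ hlo hn, h.ha _ hlo hn]
    have := le_max_left (V p) (U (p + 1)); omega
  | k + 1, lo, p, hp, hlo, hn => by
    rw [Gc_succ_left _ _ _ _ _ (by omega), h.ha _ hlo (by omega)]
    have := h.Gc_le k (lo + 1) p (by omega) (by omega) hn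
    have := le_max_right (V lo) (U (lo + 1)); omega

theorem Gc_lt (h : ColData n i U V a c) : ∀ k lo p, p = lo + k → i ≤ lo → p ≤ n →
    V p < U (p + 1) → Gc n lo a c p < U lo
  | 0, lo, p, hp, hlo, hn, hlt => by
    obtain rfl : p = lo := by omega
    rw [Gc_self_left, h.sum_c _ hlo hn, h.ha _ hlo hn, max_eq_right hlt.le]
    omega
  | k + 1, lo, p, hp, hlo, hn, hlt => by
    rw [Gc_succ_left _ _ _ _ _ (by omega), h.ha _ hlo (by omega)]
    have := h.Gc_lt k (lo + 1) p (by omega) (by omega) hn hlt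
    have := le_max_right (V lo) (U (lo + 1)); omega

theorem Gc_eq (h : ColData n i U V a c) : ∀ k lo q, q = lo + k → i ≤ lo → q ≤ n →
    U (q + 1) ≤ V q → (∀ p, lo ≤ p → p < q → V p < U (p + 1)) → Gc n lo a c q = U lo
  | 0, lo, q, hp, hlo, hn, hle, _ => by
    obtain rfl : q = lo := by omega
    rw [Gc_self_left, h.sum_c _ hlo hn, h.ha _ hlo hn, max_eq_left hle]
    omega
  | k + 1, lo, q, hp, hlo, hn, hle, hlt => by
    rw [Gc_succ_left _ _ _ _ _ (by omega), h.ha _ hlo (by omega),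
      h.Gc_eq k (lo + 1) q (by omega) (by omega) hn hle fun p h1 h2 => hlt p (by omega) h2,
      max_eq_right (hlt lo le_rfl (by omega)).le]
    omega

theorem qmc_spec (h : ColData n i U V a c) (lo : ℕ) (hlo : i ≤ lo) (hn : lo ≤ n) :
    lo ≤ qmc n lo a c ∧ qmc n lo a c ≤ n ∧ U (qmc n lo a c + 1) ≤ V (qmc n lo a c) ∧
      (∀ p, lo ≤ p → p < qmc n lo a c → V p < U (p + 1)) ∧ epsc n lo a c = U lo - V lo := by
  classical
  have hex : ∃ q, lo ≤ q ∧ q ≤ n ∧ U (q + 1) ≤ V q :=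
    ⟨n, hn, le_rfl, by rw [h.hU]; exact h.hVn⟩
  obtain ⟨q, ⟨hq1, hq2, hq3⟩, hmin⟩ :
      ∃ q, (lo ≤ q ∧ q ≤ n ∧ U (q + 1) ≤ V q) ∧ ∀ p, lo ≤ p → p < q → V p < U (p + 1) := by
    refine ⟨Nat.find hex, Nat.find_spec hex, fun p hp hlt => ?_⟩
    have h1 := Nat.find_min hex hlt
    have h2 := (Nat.find_spec hex).2.1
    by_contra hcon
    exact h1 ⟨hp, by omega, by omega⟩
  have hG := h.Gc_eq (q - lo) lo q (by omega) hlo hq2 hq3 hmin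
  have hq : qmc n lo a c = q := by
    refine qmc_eq _ _ _ _ _ hq1 hq2 (fun p hp hpn => ?_) (fun p hp hpq => ?_)
    · rw [hG]; exact h.Gc_le (p - lo) lo p (by omega) hlo hpn
    · rw [hG]; exact h.Gc_lt (p - lo) lo p (by omega) hlo (by omega) (hmin p hp hpq)
  have hE := epsc_eq n lo a c (h.hi.trans hlo) (by omega) (by omega)
  rw [hq, hG, h.sum_c lo hlo hn] at hE
  rw [hq]
  exact ⟨hq1, hq2, hq3, hmin, hE⟩

theorem lfun_spec (h : ColData n i U V a c) (s : ℕ) :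
    i ≤ lfun n i a c s ∧ lfun n i a c s ≤ n ∧
      U (lfun n i a c s + 1) ≤ V (lfun n i a c s) := by
  induction s with
  | zero =>
    obtain ⟨h1, h2, h3, -⟩ := h.qmc_spec i le_rfl h.hin
    exact ⟨h1, h2, h3⟩
  | succ s ih =>
    by_cases hs : lfun n i a c s + 1 ≤ n
    · obtain ⟨h1, h2, h3, -⟩ := h.qmc_spec (lfun n i a c s + 1) (by omega) hs
      exact ⟨by simp only [lfun]; omega, h2, h3⟩
    · have : lfun n i a c (s + 1) = n := by
        rw [lfun, qmc, if_neg hs]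
      rw [this, h.hU]
      exact ⟨h.hin, le_rfl, h.hVn⟩

theorem le_lfun (h : ColData n i U V a c) (s : ℕ) (hs : s ≤ n) : s ≤ lfun n i a c s := by
  induction s with
  | zero => omega
  | succ s ih =>
    have ih := ih (by omega)
    by_cases hs' : lfun n i a c s + 1 ≤ n
    · have h1 := (h.qmc_spec (lfun n i a c s + 1) (by have := h.lfun_spec s; omega) hs').1
      rw [lfun]; omega
    · rw [lfun, qmc, if_neg hs']; exact hs

theorem exists_lfun_of_lt (h : ColData n i U V a c) (r : ℕ) (hi : i ≤ r)
    (hr : U (r + 1) ≤ V r) (s : ℕ) (hs : r ≤ lfun n i a c s) :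
    ∃ s', s' ≤ s ∧ lfun n i a c s' = r := by
  induction s with
  | zero =>
    refine ⟨0, le_rfl, ?_⟩
    by_contra hne
    have := (h.qmc_spec i le_rfl h.hin).2.2.2.1 r hi (by rw [lfun] at hs hne; omega)
    omega
  | succ s ih =>
    rcases le_or_gt r (lfun n i a c s) with hle | hgt
    · obtain ⟨s', h1, h2⟩ := ih hle
      exact ⟨s', by omega, h2⟩
    · refine ⟨s + 1, le_rfl, ?_⟩
      have h1 := (h.lfun_spec (s + 1)).2.1
      by_contra hne
      have := (h.qmc_spec (lfun n i a c s + 1) (by have := h.lfun_spec s; omega)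
        (by omega)).2.2.2.1 r hgt (by rw [lfun] at hs hne; omega)
      omega

theorem mem_lset (h : ColData n i U V a c) (r : ℕ) (hi : i ≤ r) (hn : r ≤ n) :
    r ∈ lset n i a c ↔ U (r + 1) ≤ V r := by
  unfold lset
  rw [Finset.mem_image]
  constructor
  · rintro ⟨s, -, rfl⟩
    exact (h.lfun_spec s).2.2
  · intro hr
    obtain ⟨s, hs, rfl⟩ := h.exists_lfun_of_lt r hi hr n (hn.trans (h.le_lfun n le_rfl))
    exact ⟨s, by simp; omega, rfl⟩

theorem prcol_first (h : ColData n i U V a c) : prcol n i a c i = U i - V i := by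
  rw [prcol, if_pos rfl, (h.qmc_spec i le_rfl h.hin).2.2.2.2]

theorem prcol_of_lt (h : ColData n i U V a c) (r : ℕ) (hi : i < r) (hn : r ≤ n) :
    prcol n i a c r = min (U r) (V (r - 1)) - V r := by
  have hm := h.mem_lset (r - 1) (by omega) (by omega)
  have hr : r - 1 + 1 = r := by omega
  rw [hr] at hm
  rw [prcol, if_neg (by omega), (h.qmc_spec r hi.le hn).2.2.2.2, h.hc _ (by omega) (by omega), hr]
  split_ifs with hl
  · rw [hm] at hl; rw [min_eq_left hl]
  · rw [hm] at hl; rw [min_eq_right (by omega)]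

theorem hatc_eq (h : ColData n i U V a c) (r : ℕ) (hi : i ≤ r) (hn : r ≤ n) :
    hatc n i a c r = U r - U (r + 1) := by
  have hm := h.mem_lset r hi hn
  rw [hatc]
  split_ifs with h1 h2
  · subst h1
    have := h.hVn
    rw [h.ha _ hi le_rfl, h.hc _ hi le_rfl, h.hU, h.hV, max_eq_left this]; ring
  · rw [hm] at h2
    rw [(h.qmc_spec (r + 1) (by omega) (by omega)).2.2.2.2, h.ha _ hi hn, h.hc _ hi hn,
      max_eq_left h2]; ring
  · rw [hm] at h2
    rw [h.ha _ hi hn, max_eq_right (by omega)]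

end ColData

theorem sum_min_sub_eq_sum_sub_max (Y Z : ℕ → ℤ) (s t : ℕ) (hst : s ≤ t)
    (h0 : Y s ≤ Z (s - 1)) (h1 : Y (t + 1) ≤ Z t) :
    ∑ p ∈ Icc s t, (min (Z (p - 1)) (Y p) - Z p) =
      ∑ p ∈ Icc s t, (Y p - max (Y (p + 1)) (Z p)) := by
  have key : ∀ k, s ≤ k → ∑ p ∈ Icc s k, (min (Z (p - 1)) (Y p) - Z p) =
      ∑ p ∈ Icc s k, (Y p - max (Y (p + 1)) (Z p)) + max (Y (k + 1)) (Z k) - Z k := by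
    intro k hk
    induction k, hk using Nat.le_induction with
    | base => simp; omega
    | succ k hk ih =>
      rw [Finset.sum_Icc_succ_top (by omega), Finset.sum_Icc_succ_top (by omega), ih]
      simp only [Nat.add_sub_cancel]; omega
  rw [key t hst, max_eq_right h1]; ring

/-- `L` is the table of last passage values of `A`, measured towards the corner `(i,n)`, with
boundary values `m` on column `0` and row `i - 1`, and `0` on column `i + 1` and row `n + 1`. -/
structure IsLastPassage (n i m : ℕ) (A L : Arr) : Prop where
  rec_eq : ∀ p q, 1 ≤ p → p ≤ i → i ≤ q → q ≤ n → A p q = L p q - max (L (p + 1) q) (L p (q + 1))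
  nonneg : ∀ p q, 1 ≤ p → p ≤ i → i ≤ q → q ≤ n → 0 ≤ A p q
  right : ∀ q, i ≤ q → L (i + 1) q = 0
  bot : ∀ p, 1 ≤ p → p ≤ i → L p (n + 1) = 0
  left : ∀ q, L 0 q = m
  top : ∀ p, L p (i - 1) = m
  le : L 1 i ≤ m
  two_le : 2 ≤ i
  hin : i ≤ n

namespace IsLastPassage

variable {n i m : ℕ} {A L : Arr}

theorem succ_left_le (h : IsLastPassage n i m A L) (p q : ℕ) (h1 : 1 ≤ p) (h2 : p ≤ i)
    (h3 : i ≤ q) (h4 : q ≤ n) : L (p + 1) q ≤ L p q := by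
  have := h.rec_eq p q h1 h2 h3 h4
  have := h.nonneg p q h1 h2 h3 h4
  omega

theorem succ_right_le (h : IsLastPassage n i m A L) (p q : ℕ) (h1 : 1 ≤ p) (h2 : p ≤ i)
    (h3 : i ≤ q) (h4 : q ≤ n) : L p (q + 1) ≤ L p q := by
  have := h.rec_eq p q h1 h2 h3 h4
  have := h.nonneg p q h1 h2 h3 h4
  omega

theorem L_nonneg (h : IsLastPassage n i m A L) (p q : ℕ) (h1 : 1 ≤ p) (h2 : p ≤ i + 1)
    (h3 : i ≤ q) (h4 : q ≤ n + 1) : 0 ≤ L p q := by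
  rcases h2.lt_or_eq with h2 | rfl
  · induction h4 using Nat.decreasingInduction with
    | self => rw [h.bot p h1 (by omega)]
    | of_succ q hq ih =>
      exact (ih (by omega)).trans (h.succ_right_le p q h1 (by omega) h3 (by omega))
  · rw [h.right q h3]

theorem L_le (h : IsLastPassage n i m A L) (p q : ℕ) (h1 : 1 ≤ p) (h2 : p ≤ i)
    (h3 : i ≤ q) (h4 : q ≤ n) : L p q ≤ m := by
  have hcol : ∀ p, 1 ≤ p → p ≤ i → L p i ≤ m := by
    intro p hp
    induction p, hp using Nat.le_induction with
    | base => intro _; exact h.le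
    | succ p hp ih =>
      intro hpi
      exact (h.succ_left_le p i hp (by omega) le_rfl h.hin).trans (ih (by omega))
  induction q, h3 using Nat.le_induction with
  | base => exact hcol p h1 h2
  | succ q hq ih => exact (h.succ_right_le p q h1 h2 hq (by omega)).trans (ih (by omega))

theorem colData (h : IsLastPassage n i m A L) (p : ℕ) (h1 : 1 ≤ p) (h2 : p < i) (c : Col)
    (hc : ∀ r, i ≤ r → r ≤ n → c r = L (p + 1) r - L (p + 1) (r + 1)) :
    ColData n i (L p) (L (p + 1)) (fun r => A p r) c where
  ha r hr hn := h.rec_eq p r h1 h2.le hr hn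
  hc := hc
  hU := h.bot p h1 h2.le
  hV := h.bot (p + 1) (by omega) h2
  hVn := h.L_nonneg (p + 1) n (by omega) (by omega) h.hin (by omega)
  hi := by omega
  hin := h.hin

theorem last_col (h : IsLastPassage n i m A L) (r : ℕ) (hr : i ≤ r) (hn : r ≤ n) :
    A i r = L i r - L i (r + 1) := by
  have h2 := h.two_le
  rw [h.rec_eq i r (by omega) le_rfl hr hn, h.right r hr, max_eq_right]
  exact h.L_nonneg i (r + 1) (by omega) (by omega) (by omega) (by omega)

theorem cseq_eq (h : IsLastPassage n i m A L) (k : ℕ) (hk : k < i) (r : ℕ) (hr : i ≤ r)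
    (hn : r ≤ n) : cseq n i A k r = L (i - k) r - L (i - k) (r + 1) := by
  induction k generalizing r with
  | zero => exact h.last_col r hr hn
  | succ k ih =>
    have e1 : i - 1 - k + 1 = i - k := by omega
    have e2 : i - 1 - k = i - (k + 1) := by omega
    have := h.colData (i - 1 - k) (by omega) (by omega) (cseq n i A k) (by
      rw [e1]; exact ih (by omega))
    rw [cseq, this.hatc_eq r hr hn, e2]

theorem prColJ_eq (h : IsLastPassage n i m A L) (p r : ℕ) (hp : 2 ≤ p) (hpi : p ≤ i)
    (hr : i ≤ r) (hn : r ≤ n) : prColJ n i A p r = min (L (p - 1) r) (L p (r - 1)) - L p r := by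
  have e1 : i - (i - p) = p := by omega
  have e2 : p - 1 + 1 = p := by omega
  have := h.colData (p - 1) (by omega) (by omega) (cseq n i A (i - p)) (by
    intro r hr hn
    rw [h.cseq_eq (i - p) (by omega) r hr hn, e1, e2])
  rw [e2] at this
  unfold prColJ
  rcases hr.lt_or_eq with hr | rfl
  · exact this.prcol_of_lt r hr hn
  · rw [this.prcol_first, h.top, min_eq_left]
    exact h.L_le _ _ (by omega) (by omega) le_rfl hn

/-- The promotion map in terms of last passage values. -/
theorem prMap_eq (h : IsLastPassage n i m A L) (p r : ℕ) : prMap n i m A p r =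
    if 1 ≤ p ∧ p ≤ i ∧ i ≤ r ∧ r ≤ n then min (L (p - 1) r) (L p (r - 1)) - L p r else 0 := by
  have h2 := h.two_le
  unfold prMap
  split_ifs with hb hp hr
  · subst hp hr
    rw [h.left, h.top, min_self]
    have e1 : ∑ j ∈ Icc r n, A r j = L r r := by
      have := sum_Icc_sub_top (L r) n (n + 1 - r) r (by omega)
      rw [h.bot r (by omega) le_rfl, sub_zero] at this
      rw [← this]
      exact Finset.sum_congr rfl fun x hx => by
        rw [mem_Icc] at hx; exact h.last_col x hx.1 hx.2
    have e2 : ∑ j ∈ Icc 2 r, prColJ n r A j r = L 1 r - L r r := by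
      have := sum_Icc_sub_top (fun p => L (p - 1) r) r (r - 1) 2 (by omega)
      simp only [Nat.add_sub_cancel] at this
      rw [← this]
      refine Finset.sum_congr rfl fun x hx => ?_
      rw [mem_Icc] at hx
      rw [h.prColJ_eq x r hx.1 hx.2 le_rfl h.hin, h.top, min_eq_left]
      exact h.L_le _ _ (by omega) (by omega) le_rfl h.hin
    rw [e1, e2]; ring
  · subst hp
    have e1 := sum_min_sub_eq_sum_sub_max (fun p => L p (r - 1)) (fun p => L p r) 1 i
      (by omega) (by simp only [Nat.sub_self, h.left]
                     exact h.L_le _ _ le_rfl (by omega) (by omega) (by omega))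
      (by rw [h.right _ (by omega)]
          exact h.L_nonneg _ _ (by omega) (by omega) (by omega) (by omega))
    have e2 : ∑ j ∈ Icc 1 i, A j (r - 1) =
        ∑ p ∈ Icc 1 i, (L p (r - 1) - max (L (p + 1) (r - 1)) (L p r)) := by
      refine Finset.sum_congr rfl fun x hx => ?_
      rw [mem_Icc] at hx
      have := h.rec_eq x (r - 1) hx.1 hx.2 (by omega) (by omega)
      rwa [show r - 1 + 1 = r by omega] at this
    rw [e2, ← e1, ← Finset.add_sum_Ioc_eq_sum_Icc (by omega : 1 ≤ i)]
    have e3 : Ioc 1 i = Icc 2 i := by ext; simp; omega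
    rw [e3, add_sub_assoc, ← Finset.sum_sub_distrib, Finset.sum_eq_zero]
    · rw [add_zero]
    · intro x hx
      rw [mem_Icc] at hx
      rw [h.prColJ_eq x r hx.1 hx.2 (by omega) (by omega)]; ring
  · exact h.prColJ_eq p r (by omega) (by omega) (by omega) (by omega)
  · rfl

end IsLastPassage

/-- Last passage values of `A` towards `(i,n)`. -/
def lastPassage (n i m : ℕ) (A : Arr) (p q : ℕ) : ℤ :=
  if p = 0 ∨ q < i then m
  else if i < p ∨ n < q then 0
  else A p q + max (lastPassage n i m A (p + 1) q) (lastPassage n i m A p (q + 1))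
termination_by (i + 1 - p) + (n + 1 - q)

theorem exists_path_lastPassage {n i m : ℕ} {A : Arr} (hA : InB n i m A) (hi : 1 ≤ i) :
    ∀ k p q, k = (i - p) + (n - q) → 1 ≤ p → p ≤ i → i ≤ q → q ≤ n →
      0 ≤ lastPassage n i m A p q ∧
      ∃ L : List (ℕ × ℕ), L ≠ [] ∧ L.head? = some (p, q) ∧ L.getLast? = some (i, n) ∧
        L.IsChain (fun β γ => γ = (β.1, β.2 + 1) ∨ γ = (β.1 + 1, β.2)) ∧
        (L.map fun β => A β.1 β.2).sum = lastPassage n i m A p q := by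
  intro k
  induction k with
  | zero =>
    intro p q hk h1 h2 h3 h4
    obtain rfl : p = i := by omega
    obtain rfl : q = n := by omega
    have e : lastPassage q p m A p q = A p q := by
      rw [lastPassage, if_neg (by omega), if_neg (by omega), lastPassage, if_neg (by omega),
        if_pos (by omega), lastPassage, if_neg (by omega), if_pos (by omega)]
      simp
    rw [e]
    exact ⟨hA.1 p q h1 h2 h3 h4, [(p, q)], by simp, by simp, by simp, by simp, by simp⟩
  | succ k ih =>
    intro p q hk h1 h2 h3 h4
    have hpos := hA.1 p q h1 h2 h3 h4
    have e : lastPassage n i m A p q =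
        A p q + max (lastPassage n i m A (p + 1) q) (lastPassage n i m A p (q + 1)) := by
      rw [lastPassage, if_neg (by omega), if_neg (by omega)]
    have ext : ∀ p' q', ((p', q') = (p, q + 1) ∨ (p', q') = (p + 1, q)) →
        lastPassage n i m A p q = A p q + lastPassage n i m A p' q' →
        (0 ≤ lastPassage n i m A p' q' ∧
          ∃ L : List (ℕ × ℕ), L ≠ [] ∧ L.head? = some (p', q') ∧ L.getLast? = some (i, n) ∧
          L.IsChain (fun β γ => γ = (β.1, β.2 + 1) ∨ γ = (β.1 + 1, β.2)) ∧
          (L.map fun β => A β.1 β.2).sum = lastPassage n i m A p' q') →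
        0 ≤ lastPassage n i m A p q ∧
        ∃ L : List (ℕ × ℕ), L ≠ [] ∧ L.head? = some (p, q) ∧ L.getLast? = some (i, n) ∧
          L.IsChain (fun β γ => γ = (β.1, β.2 + 1) ∨ γ = (β.1 + 1, β.2)) ∧
          (L.map fun β => A β.1 β.2).sum = lastPassage n i m A p q := by
      rintro p' q' hstep he ⟨h0, L, hL1, hL2, hL3, hL4, hL5⟩
      refine ⟨by omega, (p, q) :: L, by simp, by simp, ?_, ?_, ?_⟩
      · rw [List.getLast?_cons, hL3]; simp
      · cases L with
        | nil => exact absurd rfl hL1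
        | cons x L =>
          simp only [List.head?_cons, Option.some.injEq] at hL2
          subst hL2
          exact List.isChain_cons_cons.2 ⟨hstep, hL4⟩
      · rw [List.map_cons, List.sum_cons, hL5, he]
    by_cases hp : p = i
    · have h0 : lastPassage n i m A (p + 1) q = 0 := by
        rw [lastPassage, if_neg (by omega), if_pos (by omega)]
      have hr := ih p (q + 1) (by omega) h1 h2 (by omega) (by omega)
      exact ext p (q + 1) (.inl rfl) (by rw [e, h0, max_eq_right hr.1]) hr
    by_cases hq : q = n
    · have h0 : lastPassage n i m A p (q + 1) = 0 := by
        rw [lastPassage, if_neg (by omega), if_pos (by omega)]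
      have hr := ih (p + 1) q (by omega) (by omega) (by omega) (by omega) (by omega)
      exact ext (p + 1) q (.inr rfl) (by rw [e, h0, max_eq_left hr.1]) hr
    rcases le_total (lastPassage n i m A (p + 1) q) (lastPassage n i m A p (q + 1)) with hle | hle
    · exact ext p (q + 1) (.inl rfl) (by rw [e, max_eq_right hle])
        (ih p (q + 1) (by omega) h1 h2 (by omega) (by omega))
    · exact ext (p + 1) q (.inr rfl) (by rw [e, max_eq_left hle])
        (ih (p + 1) q (by omega) (by omega) (by omega) (by omega) (by omega))

theorem InB.isLastPassage {n i m : ℕ} {A : Arr} (hA : InB n i m A) (hi : 2 ≤ i) (hin : i ≤ n) :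
    IsLastPassage n i m A (lastPassage n i m A) where
  rec_eq p q h1 h2 h3 h4 := by
    rw [lastPassage, if_neg (by omega), if_neg (by omega)]; ring
  nonneg := hA.1
  right q hq := by rw [lastPassage, if_neg (by omega), if_pos (by omega)]
  bot p h1 h2 := by rw [lastPassage, if_neg (by omega), if_pos (by omega)]
  left q := by rw [lastPassage, if_pos (by omega)]
  top p := by rw [lastPassage, if_pos (by omega)]
  le := by
    obtain ⟨-, L, h1, h2, h3, h4, h5⟩ := exists_path_lastPassage hA (by omega) _ 1 i rfl le_rfl
      (by omega) le_rfl hin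
    rw [← h5]
    exact hA.2.2 L ⟨h1, h2, h3, h4⟩
  two_le := hi
  hin := hin

/-- `q` is the smallest maximizer of `F` on `[s,t]`. -/
def IsMinArgmax (s t : ℕ) (F : ℕ → ℤ) (q : ℕ) : Prop :=
  s ≤ q ∧ q ≤ t ∧ (∀ p, s ≤ p → p ≤ t → F p ≤ F q) ∧ ∀ p, s ≤ p → p < q → F p < F q

/-- `q` is the largest maximizer of `F` on `[s,t]`. -/
def IsMaxArgmax (s t : ℕ) (F : ℕ → ℤ) (q : ℕ) : Prop :=
  s ≤ q ∧ q ≤ t ∧ (∀ p, s ≤ p → p ≤ t → F p ≤ F q) ∧ ∀ p, q < p → p ≤ t → F p < F q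

/-- Two adjacent lines `a`, `b` of an array and two adjacent lines `P`, `R` of its promotion,
written through three adjacent lines `X`, `Y`, `Z` of last passage values. -/
structure LineData (s t : ℕ) (X Y Z : ℕ → ℤ) (a b P R : Col) : Prop where
  ha : ∀ p, s ≤ p → p ≤ t → a p = X p - max (X (p + 1)) (Y p)
  hb : ∀ p, s ≤ p → p ≤ t → b p = Y p - max (Y (p + 1)) (Z p)
  hP : ∀ p, s ≤ p → p ≤ t → P p = min (Y (p - 1)) (X p) - Y p
  hR : ∀ p, s ≤ p → p ≤ t → R p = min (Z (p - 1)) (Y p) - Z p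
  X_start : X s ≤ Y (s - 1)
  Y_start : Y s ≤ Z (s - 1)
  X_end : X (t + 1) ≤ Y t
  Y_end : Y (t + 1) ≤ Z t
  hst : s ≤ t

namespace LineData

variable {s t : ℕ} {X Y Z : ℕ → ℤ} {a b P R : Col}

theorem sum_P (h : LineData s t X Y Z a b P R) : ∑ p ∈ Icc s t, P p = ∑ p ∈ Icc s t, a p := by
  have := sum_min_sub_eq_sum_sub_max X Y s t h.hst h.X_start h.X_end
  rw [Finset.sum_congr rfl fun x hx => h.hP x (mem_Icc.1 hx).1 (mem_Icc.1 hx).2, this]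
  exact (Finset.sum_congr rfl fun x hx => h.ha x (mem_Icc.1 hx).1 (mem_Icc.1 hx).2).symm

theorem sum_R (h : LineData s t X Y Z a b P R) : ∑ p ∈ Icc s t, R p = ∑ p ∈ Icc s t, b p := by
  have := sum_min_sub_eq_sum_sub_max Y Z s t h.hst h.Y_start h.Y_end
  rw [Finset.sum_congr rfl fun x hx => h.hR x (mem_Icc.1 hx).1 (mem_Icc.1 hx).2, this]
  exact (Finset.sum_congr rfl fun x hx => h.hb x (mem_Icc.1 hx).1 (mem_Icc.1 hx).2).symm

theorem Gc_promoted (h : LineData s t X Y Z a b P R) (p : ℕ) (hs : s ≤ p) (ht : p ≤ t) :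
    Gc t s P R p = Gc t s a b p + max 0 (X (p + 1) - Y p) - max 0 (Y p - Z (p - 1)) := by
  induction p, hs using Nat.le_induction with
  | base =>
    rw [Gc_self_left, Gc_self_left, h.sum_R, h.hP s le_rfl h.hst, h.ha s le_rfl h.hst]
    have := h.X_start
    have := h.Y_start
    omega
  | succ p hp ih =>
    rw [Gc_succ _ _ _ _ _ hp ht, Gc_succ _ _ _ _ _ hp ht, ih (by omega),
      h.hP (p + 1) (by omega) ht, h.hR p hp (by omega), h.ha (p + 1) (by omega) ht,
      h.hb p hp (by omega)]
    simp only [Nat.add_sub_cancel]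
    omega

theorem Gc_promoted_succ (h : LineData s t X Y Z a b P R) (p : ℕ) (hs : s ≤ p) (ht : p < t) :
    Gc t s P R (p + 1) = Gc t s a b p + (X (p + 1) - Y p) - (Y (p + 1) - Z p) := by
  rw [Gc_succ _ _ _ _ _ hs ht, h.Gc_promoted p hs (by omega),
    h.hP (p + 1) (by omega) ht, h.hR p hs (by omega)]
  simp only [Nat.add_sub_cancel]
  omega

theorem prefix_le_iff (h : LineData s t X Y Z a b P R) (c : ℤ) (k : ℕ) (hs : s ≤ k)
    (ht : k ≤ t) : (∀ p, s ≤ p → p ≤ k → Gc t s P R p ≤ c) ↔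
      (∀ p, s ≤ p → p ≤ k → Gc t s a b p ≤ c) ∧ Gc t s a b k + (X (k + 1) - Y k) ≤ c := by
  induction k, hs using Nat.le_induction with
  | base =>
    have h1 := h.Gc_promoted s le_rfl h.hst
    have h2 := h.Y_start
    have one : ∀ F : ℕ → ℤ, (∀ p, s ≤ p → p ≤ s → F p ≤ c) ↔ F s ≤ c := fun F =>
      ⟨fun hF => hF s le_rfl le_rfl, fun hF p hp hp' => by rwa [le_antisymm hp' hp]⟩
    rw [one, one]
    omega
  | succ k hk ih =>
    have ih := ih (by omega)
    have h1 := h.Gc_promoted_succ k hk ht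
    have h2 := h.Gc_promoted (k + 1) (by omega) ht
    simp only [Nat.add_sub_cancel] at h2
    have one : ∀ F : ℕ → ℤ, (∀ p, s ≤ p → p ≤ k + 1 → F p ≤ c) ↔
        (∀ p, s ≤ p → p ≤ k → F p ≤ c) ∧ F (k + 1) ≤ c := fun F =>
      ⟨fun hF => ⟨fun p hp hp' => hF p hp (by omega), hF _ (by omega) le_rfl⟩,
        fun hF p hp hp' => by
          rcases hp'.lt_or_eq with hlt | rfl
          · exact hF.1 p hp (by omega)
          · exact hF.2⟩
    rw [one, one, ih, and_assoc, and_assoc]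
    refine and_congr_right fun _ => ?_
    omega

theorem suffix_le_iff (h : LineData s t X Y Z a b P R) (c : ℤ) (k : ℕ) (hs : s ≤ k)
    (ht : k < t) : ((∀ p, k < p → p ≤ t → Gc t s P R p ≤ c) ∧
      Gc t s a b k + (X (k + 1) - Y k) ≤ c) ↔ ∀ p, k < p → p ≤ t → Gc t s a b p ≤ c := by
  have step : ∀ k, s ≤ k → k < t → ((Gc t s P R (k + 1) ≤ c ∧
      Gc t s a b k + (X (k + 1) - Y k) ≤ c) ↔
      (Gc t s a b (k + 1) ≤ c ∧ Gc t s a b (k + 1) + (X (k + 1 + 1) - Y (k + 1)) ≤ c)) := by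
    intro k hk ht
    have h1 := h.Gc_promoted_succ k hk ht
    have h2 := h.Gc_promoted (k + 1) (by omega) ht
    simp only [Nat.add_sub_cancel] at h2
    omega
  have one : ∀ (F : ℕ → ℤ) (k : ℕ), k < t → ((∀ p, k < p → p ≤ t → F p ≤ c) ↔
      F (k + 1) ≤ c ∧ ∀ p, k + 1 < p → p ≤ t → F p ≤ c) := fun F k hk =>
    ⟨fun hF => ⟨hF _ (by omega) (by omega), fun p hp hp' => hF p (by omega) hp'⟩,
      fun hF p hp hp' => by
        rcases (Nat.succ_le_of_lt hp).lt_or_eq with hlt | rfl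
        · exact hF.2 p hlt hp'
        · exact hF.1⟩
  obtain ⟨d, hd⟩ : ∃ d, t = k + 1 + d := ⟨t - (k + 1), by omega⟩
  have hk := step k hs ht
  induction d generalizing k with
  | zero =>
    obtain rfl : t = k + 1 := by omega
    have vac : ∀ F : ℕ → ℤ, (∀ p, k + 1 < p → p ≤ k + 1 → F p ≤ c) ↔ True := fun F =>
      iff_true_intro fun p hp hp' => by omega
    rw [one _ _ ht, one _ _ ht, vac, vac]
    have := h.X_end
    simp only [and_true]
    omega
  | succ d ih =>
    have := ih (k + 1) (by omega) (by omega) (by omega) (step _ (by omega) (by omega))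
    rw [one _ _ ht, one _ _ ht]
    tauto

theorem minArgmax_spec (h : LineData s t X Y Z a b P R) (q q' : ℕ)
    (hq : IsMinArgmax s t (Gc t s a b) q) (hq' : IsMinArgmax s t (Gc t s P R) q') :
    Gc t s P R q' = Gc t s a b q ∧ q' ≤ q ∧ X (q + 1) ≤ Y q ∧
      (∀ p, q' ≤ p → p < q → Y p < X (p + 1)) ∧ (∀ p, q' < p → p ≤ q → Z (p - 1) ≤ Y p) ∧
      (s < q' → Y q' < Z (q' - 1)) := by
  obtain ⟨h1, h2, h3, h4⟩ := hq
  obtain ⟨h1', h2', h3', h4'⟩ := hq'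
  have hend := h.X_end
  have hM : Gc t s P R q' = Gc t s a b q := by
    apply le_antisymm
    · refine (h.prefix_le_iff _ t h.hst le_rfl).2 ⟨h3, ?_⟩ q' h1' h2'
      have := h3 t h.hst le_rfl
      omega
    · exact ((h.prefix_le_iff _ t h.hst le_rfl).1 h3').1 q h1 h2
  have hT : ∀ k, s ≤ k → k ≤ t → Gc t s a b k + (X (k + 1) - Y k) ≤ Gc t s a b q :=
    fun k hk hk' => ((h.prefix_le_iff _ k hk hk').1 fun p hp hp' =>
      (h3' p hp (by omega)).trans hM.le).2
  have hle : q' ≤ q := by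
    by_contra hcon
    have := ((h.prefix_le_iff (Gc t s a b q - 1) q h1 h2).1 fun p hp hp' => by
      have := h4' p hp (by omega); omega).1 q h1 le_rfl
    omega
  have hTeq : ∀ p, q' ≤ p → p < q → Gc t s a b q ≤ Gc t s a b p + (X (p + 1) - Y p) := by
    intro p hp hpq
    by_contra hcon
    have := (h.prefix_le_iff (Gc t s a b q - 1) p (by omega) (by omega)).2
      ⟨fun r hr hr' => by have := h4 r hr (by omega); omega, by omega⟩ q' h1' hp
    omega
  refine ⟨hM, hle, ?_, fun p hp hpq => ?_, fun p hp hpq => ?_, fun hs => ?_⟩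
  · have := hT q h1 h2; omega
  · have := hTeq p hp hpq
    have := h4 p (by omega) hpq
    omega
  · obtain ⟨p, rfl⟩ : ∃ r, p = r + 1 := ⟨p - 1, by omega⟩
    have e1 := h.Gc_promoted_succ p (by omega) (by omega)
    have e2 := hTeq p (by omega) (by omega)
    have e3 := h3' (p + 1) (by omega) (by omega)
    simp only [Nat.add_sub_cancel]
    omega
  · obtain ⟨p, rfl⟩ : ∃ r, q' = r + 1 := ⟨q' - 1, by omega⟩
    have e1 := h.Gc_promoted_succ p (by omega) (by omega)
    have e2 := ((h.prefix_le_iff (Gc t s a b q - 1) p (by omega) (by omega)).1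
      fun r hr hr' => by have := h4' r hr (by omega); omega).2
    simp only [Nat.add_sub_cancel]
    omega

theorem maxArgmax_spec (h : LineData s t X Y Z a b P R) (q q' : ℕ)
    (hq : IsMaxArgmax s t (Gc t s a b) q) (hq' : IsMaxArgmax s t (Gc t s P R) q') :
    Gc t s P R q' = Gc t s a b q ∧ q' ≤ q ∧ (q < t → X (q + 1) < Y q) ∧
      (∀ p, q' ≤ p → p < q → Y p ≤ X (p + 1)) ∧ (∀ p, q' < p → p ≤ q → Z (p - 1) < Y p) ∧
      Y q' ≤ Z (q' - 1) := by
  obtain ⟨h1, h2, h3, h4⟩ := hq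
  obtain ⟨h1', h2', h3', h4'⟩ := hq'
  have hend := h.X_end
  have hM : Gc t s P R q' = Gc t s a b q := by
    apply le_antisymm
    · refine (h.prefix_le_iff _ t h.hst le_rfl).2 ⟨h3, ?_⟩ q' h1' h2'
      have := h3 t h.hst le_rfl
      omega
    · exact ((h.prefix_le_iff _ t h.hst le_rfl).1 h3').1 q h1 h2
  have hT : ∀ k, s ≤ k → k ≤ t → Gc t s a b k + (X (k + 1) - Y k) ≤ Gc t s a b q :=
    fun k hk hk' => ((h.prefix_le_iff _ k hk hk').1 fun p hp hp' =>
      (h3' p hp (by omega)).trans hM.le).2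
  have hlt : q < t → ∀ p, q < p → p ≤ t → Gc t s a b p ≤ Gc t s a b q - 1 :=
    fun _ p hp hp' => by have := h4 p hp hp'; omega
  have hle : q' ≤ q := by
    by_contra hcon
    have := ((h.suffix_le_iff _ q h1 (by omega)).2 (hlt (by omega))).1 q' (by omega) h2'
    omega
  have hTeq : ∀ p, q' ≤ p → p < q → Gc t s a b q ≤ Gc t s a b p + (X (p + 1) - Y p) := by
    intro p hp hpq
    by_contra hcon
    have := (h.suffix_le_iff (Gc t s a b q - 1) p (by omega) (by omega)).1
      ⟨fun r hr hr' => by have := h4' r (by omega) hr'; omega, by omega⟩ q hpq h2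
    omega
  refine ⟨hM, hle, fun hqt => ?_, fun p hp hpq => ?_, fun p hp hpq => ?_, ?_⟩
  · have := ((h.suffix_le_iff _ q h1 hqt).2 (hlt hqt)).2; omega
  · have := hTeq p hp hpq
    have := h3 p (by omega) (by omega)
    omega
  · obtain ⟨p, rfl⟩ : ∃ r, p = r + 1 := ⟨p - 1, by omega⟩
    have e1 := h.Gc_promoted_succ p (by omega) (by omega)
    have e2 := hTeq p (by omega) (by omega)
    have e3 := h4' (p + 1) (by omega) (by omega)
    simp only [Nat.add_sub_cancel]
    omega
  · rcases h1'.lt_or_eq with hs | rfl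
    · obtain ⟨p, rfl⟩ : ∃ r, q' = r + 1 := ⟨q' - 1, by omega⟩
      have e1 := h.Gc_promoted_succ p (by omega) (by omega)
      have e2 := hT p (by omega) (by omega)
      simp only [Nat.add_sub_cancel]
      omega
    · exact h.Y_start

end LineData

theorem Gc_self_right (t s : ℕ) (a b : Col) :
    Gc t s a b t = ∑ j ∈ Icc s t, a j + b t := by
  simp [Gc]

theorem exists_isMinArgmax (s t : ℕ) (hst : s ≤ t) (F : ℕ → ℤ) :
    IsMinArgmax s t F (sInf {p | p ∈ Icc s t ∧ ∀ q ∈ Icc s t, F q ≤ F p}) := by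
  have hne : {p | p ∈ Icc s t ∧ ∀ q ∈ Icc s t, F q ≤ F p}.Nonempty := by
    obtain ⟨p, hp, hmax⟩ := (Icc s t).exists_max_image F ⟨s, by simp [hst]⟩
    exact ⟨p, hp, hmax⟩
  have hmem := Nat.sInf_mem hne
  have hlow := fun p => Nat.sInf_le (m := p) (s := {p | p ∈ Icc s t ∧ ∀ q ∈ Icc s t, F q ≤ F p})
  set x := sInf {p | p ∈ Icc s t ∧ ∀ q ∈ Icc s t, F q ≤ F p}
  obtain ⟨h1, h2⟩ := hmem
  rw [mem_Icc] at h1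
  refine ⟨h1.1, h1.2, fun p hp hp' => h2 p (mem_Icc.2 ⟨hp, hp'⟩), fun p hp hpx => ?_⟩
  by_contra hcon
  have := hlow p ⟨mem_Icc.2 ⟨hp, by omega⟩, fun q hq => (h2 q hq).trans (by omega)⟩
  omega

theorem exists_isMaxArgmax (s t : ℕ) (hst : s ≤ t) (F : ℕ → ℤ) :
    IsMaxArgmax s t F (sSup {p | p ∈ Icc s t ∧ ∀ q ∈ Icc s t, F q ≤ F p}) := by
  have hne : {p | p ∈ Icc s t ∧ ∀ q ∈ Icc s t, F q ≤ F p}.Nonempty := by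
    obtain ⟨p, hp, hmax⟩ := (Icc s t).exists_max_image F ⟨s, by simp [hst]⟩
    exact ⟨p, hp, hmax⟩
  have hbdd : BddAbove {p | p ∈ Icc s t ∧ ∀ q ∈ Icc s t, F q ≤ F p} :=
    ⟨t, fun p hp => (mem_Icc.1 hp.1).2⟩
  have hmem := Nat.sSup_mem hne hbdd
  have hup := fun p => le_csSup (a := p) hbdd
  set x := sSup {p | p ∈ Icc s t ∧ ∀ q ∈ Icc s t, F q ≤ F p}
  obtain ⟨h1, h2⟩ := hmem
  rw [mem_Icc] at h1
  refine ⟨h1.1, h1.2, fun p hp hp' => h2 p (mem_Icc.2 ⟨hp, hp'⟩), fun p hp hpx => ?_⟩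
  by_contra hcon
  have := hup p ⟨mem_Icc.2 ⟨by omega, hpx⟩, fun q hq => (h2 q hq).trans (by omega)⟩
  omega

/-- The raising operator between two rows. -/
theorem eop_row (n i m l : ℕ) (hi : 1 ≤ i) (hl : i < l) (B : Arr) :
    ∃ q, IsMaxArgmax 1 i (Gc i 1 (fun p => B p (l - 1)) (fun p => B p l)) q ∧
      eop n i m l B =
        if Gc i 1 (fun p => B p (l - 1)) (fun p => B p l) q = ∑ p ∈ Icc 1 i, B p (l - 1) then none
        else some (upd (upd B q (l - 1) (B q (l - 1) + 1)) q l (B q l - 1)) := by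
  have hq : IsMaxArgmax 1 i (Gc i 1 (fun p => B p (l - 1)) (fun p => B p l)) (qplus i B l) :=
    exists_isMaxArgmax 1 i hi _
  refine ⟨_, hq, ?_⟩
  have hsum : ∑ p ∈ Icc 1 i, B p (l - 1) = ∑ j ∈ Icc 1 (qplus i B l), B j (l - 1) +
      ∑ j ∈ Icc (qplus i B l + 1) i, B j (l - 1) := by
    obtain ⟨h1, h2, -, -⟩ := hq
    rw [← Finset.sum_union]
    · congr 1; ext; simp; omega
    · rw [Finset.disjoint_left]; intro x; simp; omega
  have he : eps n i m l B = Gc i 1 (fun p => B p (l - 1)) (fun p => B p l) (qplus i B l) -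
      ∑ p ∈ Icc 1 i, B p (l - 1) := by
    rw [eps, if_neg (by omega), if_pos hl, hsum, Gc]; ring
  rw [eop, he, if_neg (by omega : ¬ l = i), if_pos hl]
  simp only [sub_eq_zero]

/-- The raising operator between two columns. -/
theorem eop_col (n i m l : ℕ) (hin : i ≤ n) (hl : l < i) (B : Arr) :
    ∃ q, IsMinArgmax i n (Gc n i (B l) (B (l + 1))) q ∧
      eop n i m l B =
        if Gc n i (B l) (B (l + 1)) q = ∑ p ∈ Icc i n, B (l + 1) p then none
        else some (upd (upd B l q (B l q - 1)) (l + 1) q (B (l + 1) q + 1)) := by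
  have hq : IsMinArgmax i n (Gc n i (B l) (B (l + 1))) (qminus n i B l) :=
    exists_isMinArgmax i n hin _
  refine ⟨_, hq, ?_⟩
  have hsum : ∑ p ∈ Icc i n, B (l + 1) p = ∑ j ∈ Icc i (qminus n i B l - 1), B (l + 1) j +
      ∑ j ∈ Icc (qminus n i B l) n, B (l + 1) j := by
    obtain ⟨h1, h2, -, -⟩ := hq
    rw [← Finset.sum_union]
    · congr 1; ext; simp; omega
    · rw [Finset.disjoint_left]; intro x; simp; omega
  have he : eps n i m l B = Gc n i (B l) (B (l + 1)) (qminus n i B l) -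
      ∑ p ∈ Icc i n, B (l + 1) p := by
    rw [eps, if_neg (by omega), if_neg (by omega), hsum, Gc]; ring
  rw [eop, he, if_neg (by omega : ¬ l = i), if_neg (by omega : ¬ i < l)]
  simp only [sub_eq_zero]

namespace IsLastPassage

variable {n i m : ℕ} {A L : Arr}

/-- Lowering a stretch of a row of last passage values moves one unit of `A` up a row. -/
theorem row_shift (h : IsLastPassage n i m A L) {A' : Arr} (j q q' : ℕ) (hij : i ≤ j)
    (hjn : j ≤ n) (hq' : 1 ≤ q') (hqq : q' ≤ q) (hqi : q ≤ i) (hpos : 0 < A q j)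
    (hA' : ∀ p r, A' p r = if p = q ∧ r = j then A p r - 1
      else if p = q ∧ r + 1 = j ∧ i ≤ r then A p r + 1 else A p r)
    (c1 : q < i → L (q + 1) (j - 1) < L q j)
    (c2 : ∀ p, q' ≤ p → p < q → L p j ≤ L (p + 1) (j - 1))
    (c3 : ∀ p, q' < p → p ≤ q → L (p - 1) (j + 1) < L p j)
    (c4 : L q' j ≤ L (q' - 1) (j + 1)) :
    IsLastPassage n i m A' fun p r => if r = j ∧ q' ≤ p ∧ p ≤ q then L p r - 1 else L p r where
  rec_eq p r h1 h2 h3 h4 := by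
    have hrec := h.rec_eq p r h1 h2 h3 h4
    rw [hA']
    by_cases hr : r = j
    · subst hr
      have d3 := c3 (p + 1)
      simp only [Nat.add_sub_cancel] at d3
      have d4 : q' = p + 1 → L (p + 1) r ≤ L p (r + 1) := by
        rintro rfl; simpa using c4
      simp only [true_and, and_true, show ¬ r + 1 = r by omega, false_and]
      split_ifs <;> grind
    · by_cases hr' : r + 1 = j
      · subst hr'
        simp only [Nat.add_sub_cancel] at c1 c2
        have d2 := c2 p
        have hz := h.right r h3
        have hr := h.rec_eq p (r + 1) h1 h2 (by omega) hjn
        have hn := h.L_nonneg p (r + 1 + 1) h1 (by omega) (by omega) (by omega)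
        have d1 : p = q → L (p + 1) r < L p (r + 1) := by
          rintro rfl
          rcases hqi.lt_or_eq with hlt | rfl
          · exact c1 hlt
          · omega
        simp only [show ¬ r = r + 1 by omega, and_false, false_and, true_and, h3, and_true]
        split_ifs <;> grind
      · simp only [hr, hr', and_false, false_and, if_false]
        exact hrec
  nonneg p r h1 h2 h3 h4 := by
    have hn := h.nonneg p r h1 h2 h3 h4
    rw [hA']
    split_ifs with hc hc'
    · rw [hc.1, hc.2]; omega
    · omega
    · exact hn
  right r hr := by rw [if_neg (by omega)]; exact h.right r hr
  bot p h1 h2 := by rw [if_neg (by omega)]; exact h.bot p h1 h2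
  left r := by rw [if_neg (by omega)]; exact h.left r
  top p := by rw [if_neg (by have := h.two_le; omega)]; exact h.top p
  le := by have := h.le; split_ifs <;> omega
  two_le := h.two_le
  hin := h.hin

/-- Raising a stretch of a column of last passage values moves one unit of `A` to the right. -/
theorem col_shift (h : IsLastPassage n i m A L) {A' : Arr} (l q q' : ℕ) (hl : 1 ≤ l)
    (hli : l < i) (hq' : i ≤ q') (hqq : q' ≤ q) (hqn : q ≤ n) (hpos : 0 < A l q)
    (hA' : ∀ p r, A' p r = if p = l ∧ r = q then A p r - 1
      else if p = l + 1 ∧ r = q then A p r + 1 else A p r)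
    (c1 : L l (q + 1) ≤ L (l + 1) q)
    (c2 : ∀ r, q' ≤ r → r < q → L (l + 1) r < L l (r + 1))
    (c3 : ∀ r, q' < r → r ≤ q → L (l + 2) (r - 1) ≤ L (l + 1) r)
    (c4 : L (l + 1) q' < L (l + 2) (q' - 1)) :
    IsLastPassage n i m A' fun p r => if p = l + 1 ∧ q' ≤ r ∧ r ≤ q then L p r + 1 else L p r where
  rec_eq p r h1 h2 h3 h4 := by
    have hrec := h.rec_eq p r h1 h2 h3 h4
    rw [hA']
    by_cases hp : p = l
    · subst hp
      have d2 := c2 r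
      have d1 : r = q → L p (r + 1) ≤ L (p + 1) r := by rintro rfl; exact c1
      simp only [show ¬ p = p + 1 by omega, false_and, true_and]
      split_ifs <;> grind
    · by_cases hp' : p = l + 1
      · subst hp'
        have d3 := c3 (r + 1)
        simp only [Nat.add_sub_cancel] at d3
        have d4 : q' = r + 1 → L (l + 1) (r + 1) < L (l + 2) r := by
          rintro rfl; simpa using c4
        simp only [show ¬ l + 1 = l by omega, show ¬ l + 1 + 1 = l + 1 by omega, false_and,
          true_and]
        split_ifs <;> grind
      · simp only [hp, hp', show ¬ p + 1 = l + 1 by omega, false_and, if_false]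
        exact hrec
  nonneg p r h1 h2 h3 h4 := by
    have hn := h.nonneg p r h1 h2 h3 h4
    rw [hA']
    split_ifs with hc hc'
    · rw [hc.1, hc.2]; omega
    · omega
    · exact hn
  right r hr := by rw [if_neg (by omega)]; exact h.right r hr
  bot p h1 h2 := by rw [if_neg (by omega)]; exact h.bot p h1 h2
  left r := by rw [if_neg (by omega)]; exact h.left r
  top p := by rw [if_neg (by have := h.two_le; omega)]; exact h.top p
  le := by rw [if_neg (by omega)]; exact h.le
  two_le := h.two_le
  hin := h.hin

theorem prMap_row_shift (h : IsLastPassage n i m A L) {A' : Arr} (j q q' : ℕ) (hij : i ≤ j)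
    (hjn : j < n) (hq' : 1 ≤ q') (hqq : q' ≤ q) (hqi : q ≤ i) (hpos : 0 < A q j)
    (hA' : ∀ p r, A' p r = if p = q ∧ r = j then A p r - 1
      else if p = q ∧ r + 1 = j ∧ i ≤ r then A p r + 1 else A p r)
    (c1 : q < i → L (q + 1) (j - 1) < L q j)
    (c2 : ∀ p, q' ≤ p → p < q → L p j ≤ L (p + 1) (j - 1))
    (c3 : ∀ p, q' < p → p ≤ q → L (p - 1) (j + 1) < L p j)
    (c4 : L q' j ≤ L (q' - 1) (j + 1)) (p r : ℕ) :
    prMap n i m A' p r = if p = q' ∧ r = j then prMap n i m A p r + 1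
      else if p = q' ∧ r = j + 1 then prMap n i m A p r - 1 else prMap n i m A p r := by
  rw [(h.row_shift j q q' hij hjn.le hq' hqq hqi hpos hA' c1 c2 c3 c4).prMap_eq, h.prMap_eq]
  by_cases hb : 1 ≤ p ∧ p ≤ i ∧ i ≤ r ∧ r ≤ n
  swap
  · rw [if_neg hb, if_neg hb, if_neg (by omega), if_neg (by omega)]
  rw [if_pos hb, if_pos hb]
  obtain ⟨p, rfl⟩ : ∃ k, p = k + 1 := ⟨p - 1, by omega⟩
  simp only [Nat.add_sub_cancel]
  by_cases hr : r = j
  · subst hr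
    have d2 := c2 p
    have d1 : p = q → L (p + 1) (r - 1) < L p r := by rintro rfl; exact c1 (by omega)
    simp only [true_and, and_true, show ¬ r - 1 = r by omega, show ¬ r = r + 1 by omega,
      false_and, and_false]
    split_ifs <;> grind
  · by_cases hr' : r = j + 1
    · subst hr'
      have d3 := c3 (p + 1)
      have d4 : q' = p + 1 → L (p + 1) j ≤ L p (j + 1) := by rintro rfl; simpa using c4
      simp only [Nat.add_sub_cancel] at d3 ⊢
      simp only [show ¬ j + 1 = j by omega, false_and, true_and, and_false, and_true]
      split_ifs <;> grind
    · simp only [hr, hr', show ¬ r - 1 = j by omega, and_false, false_and, if_false]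

theorem prMap_col_shift (h : IsLastPassage n i m A L) {A' : Arr} (l q q' : ℕ) (hl : 1 ≤ l)
    (hli : l < i) (hq' : i ≤ q') (hqq : q' ≤ q) (hqn : q ≤ n) (hpos : 0 < A l q)
    (hA' : ∀ p r, A' p r = if p = l ∧ r = q then A p r - 1
      else if p = l + 1 ∧ r = q then A p r + 1 else A p r)
    (c1 : L l (q + 1) ≤ L (l + 1) q)
    (c2 : ∀ r, q' ≤ r → r < q → L (l + 1) r < L l (r + 1))
    (c3 : ∀ r, q' < r → r ≤ q → L (l + 2) (r - 1) ≤ L (l + 1) r)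
    (c4 : L (l + 1) q' < L (l + 2) (q' - 1)) (p r : ℕ) :
    prMap n i m A' p r = if p = l + 1 ∧ r = q' then prMap n i m A p r - 1
      else if p = l + 2 ∧ r = q' ∧ l + 2 ≤ i then prMap n i m A p r + 1
      else prMap n i m A p r := by
  rw [(h.col_shift l q q' hl hli hq' hqq hqn hpos hA' c1 c2 c3 c4).prMap_eq, h.prMap_eq]
  by_cases hb : 1 ≤ p ∧ p ≤ i ∧ i ≤ r ∧ r ≤ n
  swap
  · rw [if_neg hb, if_neg hb, if_neg (by omega), if_neg (by omega)]
  rw [if_pos hb, if_pos hb]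
  obtain ⟨r, rfl⟩ : ∃ k, r = k + 1 := ⟨r - 1, by have := h.two_le; omega⟩
  simp only [Nat.add_sub_cancel]
  by_cases hp : p = l + 1
  · subst hp
    have d2 := c2 r
    have d1 : r = q → L l (r + 1) ≤ L (l + 1) r := by rintro rfl; exact c1
    simp only [Nat.add_sub_cancel, show ¬ l = l + 1 by omega, show ¬ l + 1 = l + 2 by omega,
      false_and, true_and]
    split_ifs <;> grind
  · by_cases hp' : p = l + 2
    · subst hp'
      have d3 := c3 (r + 1)
      have d4 : q' = r + 1 → L (l + 1) (r + 1) < L (l + 2) r := by rintro rfl; simpa using c4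
      simp only [Nat.add_sub_cancel] at d3
      simp only [show l + 2 - 1 = l + 1 by omega, show ¬ l + 2 = l + 1 by omega, false_and,
        true_and]
      split_ifs <;> grind
    · simp only [hp, hp', show ¬ p - 1 = l + 1 by omega, false_and, if_false]

theorem row_lineData (h : IsLastPassage n i m A L) (j : ℕ) (hij : i ≤ j) (hjn : j < n) (a : Col)
    (ha : ∀ p, 1 ≤ p → p ≤ i →
      a p = L p (j - 1) - max (if p = i then 0 else L (p + 1) (j - 1)) (L p j)) :
    LineData 1 i (fun p => if p = i + 1 then 0 else L p (j - 1)) (fun p => L p j)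
      (fun p => L p (j + 1)) a (fun p => A p j) (fun p => prMap n i m A p j)
      (fun p => prMap n i m A p (j + 1)) where
  ha p h1 h2 := by
    rw [ha p h1 h2]
    simp only [show ¬ p = i + 1 by omega, if_false, Nat.add_right_cancel_iff]
  hb p h1 h2 := h.rec_eq p j h1 h2 hij hjn.le
  hP p h1 h2 := by
    rw [h.prMap_eq, if_pos ⟨h1, h2, hij, hjn.le⟩]
    simp only [show ¬ p = i + 1 by omega, if_false]
  hR p h1 h2 := by
    rw [h.prMap_eq, if_pos ⟨h1, h2, by omega, by omega⟩]
    simp only [Nat.add_sub_cancel]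
  X_start := by
    have := h.two_le
    simp only [show ¬ 1 = i + 1 by omega, if_false, Nat.sub_self, h.left]
    rcases hij.lt_or_eq with hlt | rfl
    · exact h.L_le 1 (j - 1) le_rfl (by omega) (by omega) (by omega)
    · rw [h.top]
  Y_start := by
    have := h.two_le
    simp only [Nat.sub_self, h.left]
    exact h.L_le 1 j le_rfl (by omega) hij hjn.le
  X_end := by
    have := h.two_le
    simp only [if_true]
    exact h.L_nonneg i j (by omega) (by omega) hij (by omega)
  Y_end := by
    have := h.two_le
    simp only [h.right j hij]
    exact h.L_nonneg i (j + 1) (by omega) (by omega) (by omega) (by omega)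
  hst := by have := h.two_le; omega

theorem col_lineData (h : IsLastPassage n i m A L) (l : ℕ) (hl : 1 ≤ l) (hli : l < i) (R : Col)
    (hR : ∀ r, i ≤ r → r ≤ n → R r = min (L (l + 2) (r - 1)) (L (l + 1) r) - L (l + 2) r) :
    LineData i n (L l) (L (l + 1)) (L (l + 2)) (A l) (A (l + 1)) (prMap n i m A (l + 1)) R where
  ha r h1 h2 := by rw [h.rec_eq l r hl hli.le h1 h2, max_comm]
  hb r h1 h2 := by rw [h.rec_eq (l + 1) r (by omega) hli h1 h2, max_comm]
  hP r h1 h2 := by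
    rw [h.prMap_eq, if_pos ⟨by omega, hli, h1, h2⟩, Nat.add_sub_cancel, min_comm]
  hR := hR
  X_start := by rw [h.top]; exact h.L_le l i hl hli.le le_rfl h.hin
  Y_start := by rw [h.top]; exact h.L_le (l + 1) i (by omega) hli le_rfl h.hin
  X_end := by
    rw [h.bot l hl hli.le]
    exact h.L_nonneg (l + 1) n (by omega) (by omega) h.hin (by omega)
  Y_end := by
    rw [h.bot (l + 1) (by omega) hli]
    exact h.L_nonneg (l + 2) n (by omega) (by omega) h.hin (by omega)
  hst := h.hin

theorem map_prMap_row (h : IsLastPassage n i m A L) (j : ℕ) (hij : i ≤ j) (hjn : j < n) (a : Col)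
    (ha : ∀ p, 1 ≤ p → p ≤ i →
      a p = L p (j - 1) - max (if p = i then 0 else L (p + 1) (j - 1)) (L p j))
    (ha0 : ∀ p, 1 ≤ p → p ≤ i → 0 ≤ a p) (q : ℕ)
    (hq : IsMaxArgmax 1 i (Gc i 1 a fun p => A p j) q) {A' : Arr}
    (hA' : ∀ p r, A' p r = if p = q ∧ r = j then A p r - 1
      else if p = q ∧ r + 1 = j ∧ i ≤ r then A p r + 1 else A p r) :
    Option.map (prMap n i m)
        (if Gc i 1 a (fun p => A p j) q = ∑ p ∈ Icc 1 i, a p then none else some A') =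
      eop n i m (j + 1) (prMap n i m A) := by
  have hi := h.two_le
  obtain ⟨q', hq', he⟩ := eop_row n i m (j + 1) (by omega) (by omega) (prMap n i m A)
  rw [he]
  simp only [Nat.add_sub_cancel] at hq' ⊢
  have hD := h.row_lineData j hij hjn a ha
  obtain ⟨hG, hqq, c1, c2, c3, c4⟩ := hD.maxArgmax_spec q q' hq hq'
  rw [hG, hD.sum_P]
  split_ifs with hc
  · rfl
  obtain ⟨hq1, hqi, hqm, hqs⟩ := hq
  have hpos : 0 < A q j := by
    rcases hqi.lt_or_eq with hlt | rfl
    · have h1 := Gc_succ i 1 q a (fun p => A p j) hq1 hlt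
      have h2 := hqs (q + 1) (by omega) (by omega)
      have h3 := ha0 (q + 1) (by omega) (by omega)
      omega
    · rw [Gc_self_right] at hc
      have := h.nonneg q j hq1 le_rfl hij hjn.le
      omega
  have hq'1 := hq'.1
  rw [Option.map_some, Option.some_inj]
  funext p r
  rw [h.prMap_row_shift j q q' hij hjn hq'1 hqq hqi hpos hA'
    (fun hlt => by simpa [show q ≠ i by omega] using c1 hlt)
    (fun p h1 h2 => by simpa [show p ≠ i by omega] using c2 p h1 h2) c3 c4]
  simp only [upd]
  grind

theorem map_prMap_col (h : IsLastPassage n i m A L) (l : ℕ) (hl : 1 ≤ l) (hli : l < i) (R : Col)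
    (hR : ∀ r, i ≤ r → r ≤ n → R r = min (L (l + 2) (r - 1)) (L (l + 1) r) - L (l + 2) r)
    (q' : ℕ) (hq' : IsMinArgmax i n (Gc n i (prMap n i m A (l + 1)) R) q') {B' : Arr}
    (hB' : ∀ p r, B' p r = if p = l + 1 ∧ r = q' then prMap n i m A p r - 1
      else if p = l + 2 ∧ r = q' ∧ l + 2 ≤ i then prMap n i m A p r + 1
      else prMap n i m A p r) :
    Option.map (prMap n i m) (eop n i m l A) =
      if Gc n i (prMap n i m A (l + 1)) R q' = ∑ r ∈ Icc i n, R r then none else some B' := by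
  have hi := h.two_le
  have hin := h.hin
  obtain ⟨q, hq, he⟩ := eop_col n i m l hin hli A
  rw [he]
  have hD := h.col_lineData l hl hli R hR
  obtain ⟨hG, hqq, c1, c2, c3, c4⟩ := hD.minArgmax_spec q q' hq hq'
  rw [hG, hD.sum_R]
  split_ifs with hc
  · rfl
  obtain ⟨hq1, hqn, hqm, hqs⟩ := hq
  have hpos : 0 < A l q := by
    rcases hq1.lt_or_eq with hlt | rfl
    · obtain ⟨k, rfl⟩ : ∃ k, q = k + 1 := ⟨q - 1, by omega⟩
      have h1 := Gc_succ n i k (A l) (A (l + 1)) (by omega) (by omega)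
      have h2 := hqs k (by omega) (by omega)
      have h3 := h.nonneg (l + 1) k (by omega) (by omega) (by omega) (by omega)
      omega
    · rw [Gc_self_left] at hc
      have := h.nonneg l i hl hli.le le_rfl hin
      omega
  have hq'1 := hq'.1
  have c4' : L (l + 1) q' < L (l + 2) (q' - 1) := by
    rcases hq'1.lt_or_eq with hlt | rfl
    · exact c4 hlt
    · rw [← hG, Gc_self_left, ← hD.sum_R] at hc
      have h1 := hD.hP i le_rfl hin
      have h2 := h.L_le l i hl hli.le le_rfl hin
      have h3 := h.L_le (l + 1) i (by omega) hli le_rfl hin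
      rw [h.top] at h1 ⊢
      have h4 := h.succ_left_le l i hl hli.le le_rfl hin
      omega
  rw [Option.map_some, Option.some_inj]
  funext p r
  rw [h.prMap_col_shift (A' := upd (upd A l q (A l q - 1)) (l + 1) q (A (l + 1) q + 1))
    l q q' hl hli hq'1 hqq hqn hpos (by intro p r; simp only [upd]; grind) c1 c2 c3 c4', hB']

theorem map_prMap_first_row (h : IsLastPassage n i m A L) (hin : i < n) :
    Option.map (prMap n i m) (eop n i m i A) = eop n i m (i + 1) (prMap n i m A) := by
  have hi := h.two_le
  set a : Col := fun p => m - max (if p = i then 0 else (m : ℤ)) (L p i) with ha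
  have hL : ∀ p, 1 ≤ p → p ≤ i → L p i ≤ m := fun p h1 h2 => h.L_le p i h1 h2 le_rfl hin.le
  have hLi := h.L_nonneg i i (by omega) (by omega) le_rfl (by omega)
  have ha_last : a i = m - L i i := by simp [ha, hLi]
  have ha_lt : ∀ p, 1 ≤ p → p < i → a p = 0 := by
    intro p h1 h2
    have := hL p h1 h2.le
    simp only [ha, if_neg (show ¬ p = i by omega)]
    omega
  have hlt : ∀ k p, p + k + 1 = i → 1 ≤ p →
      Gc i 1 a (fun p => A p i) p ≤ Gc i 1 a (fun p => A p i) i - (m - L p i) := by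
    intro k
    induction k with
    | zero =>
      intro p hp h1
      have h2 := Gc_succ i 1 p a (fun p => A p i) h1 (by omega)
      have h3 := h.rec_eq p i h1 (by omega) le_rfl hin.le
      obtain rfl : p + 1 = i := by omega
      omega
    | succ k ih =>
      intro p hp h1
      have ih := ih (p + 1) (by omega) (by omega)
      have h2 := Gc_succ i 1 p a (fun p => A p i) h1 (by omega)
      have h3 := h.rec_eq p i h1 (by omega) le_rfl hin.le
      have h4 := ha_lt (p + 1) (by omega) (by omega)
      omega
  have hq : IsMaxArgmax 1 i (Gc i 1 a fun p => A p i) i := by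
    refine ⟨by omega, le_rfl, fun p h1 h2 => ?_, fun p h1 h2 => by omega⟩
    rcases h2.lt_or_eq with h3 | rfl
    · have := hlt (i - p - 1) p (by omega) h1
      have := hL p h1 h2
      omega
    · rfl
  rw [← h.map_prMap_row (A' := upd A i i (A i i - 1)) i le_rfl hin a
    (fun p h1 h2 => by simp only [ha, h.top]) (fun p h1 h2 => ?_) i hq (fun p r => ?_)]
  · rw [Gc_self_right]
    simp only [eop, eps, if_true, add_eq_left]
  · rcases h2.lt_or_eq with h3 | rfl
    · exact (ha_lt p h1 h3).ge
    · have := hL p h1 le_rfl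
      omega
  · simp only [upd]
    grind

theorem map_prMap_last_col (h : IsLastPassage n i m A L) (l : ℕ) (hl : 1 ≤ l) (hli : l + 1 = i) :
    Option.map (prMap n i m) (eop n i m l A) = eop n i m i (prMap n i m A) := by
  have hin := h.hin
  subst hli
  set R : Col := fun r => min (L (l + 2) (r - 1)) (L (l + 1) r) - L (l + 2) r with hR
  have hLi : ∀ r, l + 1 ≤ r → r ≤ n → 0 ≤ L (l + 1) r := fun r h1 h2 =>
    h.L_nonneg (l + 1) r (by omega) (by omega) h1 (by omega)
  have hR_first : R (l + 1) = L (l + 1) (l + 1) := by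
    have h1 := h.top (l + 2)
    have h2 := h.L_le (l + 1) (l + 1) (by omega) le_rfl le_rfl hin
    simp only [hR, h.right (l + 1) le_rfl, h1]
    omega
  have hR_lt : ∀ r, l + 1 < r → r ≤ n → R r = 0 := by
    intro r h1 h2
    have := hLi r (by omega) h2
    simp only [hR, h.right r (by omega), h.right (r - 1) (by omega)]
    omega
  have hlt : ∀ r, l + 1 + 1 ≤ r → r ≤ n → Gc n (l + 1) (prMap n (l + 1) m A (l + 1)) R r ≤
      Gc n (l + 1) (prMap n (l + 1) m A (l + 1)) R (l + 1) - L (l + 1) r := by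
    intro r h1
    induction r, h1 using Nat.le_induction with
    | base =>
      intro h2
      have h3 := h.prMap_eq (l + 1) (l + 1 + 1)
      rw [if_pos ⟨by omega, le_rfl, by omega, h2⟩, Nat.add_sub_cancel] at h3
      rw [Gc_succ _ _ _ _ _ le_rfl h2]
      simp only [Nat.add_sub_cancel] at h3
      omega
    | succ r h1 ih =>
      intro h2
      have h3 := h.prMap_eq (l + 1) (r + 1)
      rw [if_pos ⟨by omega, le_rfl, by omega, h2⟩, Nat.add_sub_cancel] at h3
      have h4 := hR_lt r h1 (by omega)
      have ih := ih (by omega)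
      rw [Gc_succ _ _ _ _ _ (by omega) h2]
      simp only [Nat.add_sub_cancel] at h3
      omega
  have hq : IsMinArgmax (l + 1) n (Gc n (l + 1) (prMap n (l + 1) m A (l + 1)) R) (l + 1) := by
    refine ⟨le_rfl, hin, fun r h1 h2 => ?_, fun p h1 h2 => by omega⟩
    rcases h1.lt_or_eq with h3 | rfl
    · have := hlt r h3 h2
      have := hLi r h1 h2
      omega
    · rfl
  rw [h.map_prMap_col l hl (by omega) R (fun r _ _ => rfl) (l + 1) hq
    (B' := upd (prMap n (l + 1) m A) (l + 1) (l + 1) (prMap n (l + 1) m A (l + 1) (l + 1) - 1))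
    (fun p r => by simp only [upd]; grind)]
  rw [Gc_self_left]
  simp only [eop, eps, if_true, add_eq_right]

end IsLastPassage

/-- The promotion map intertwines the raising operators with an
index shift: `pr(e_j A) = e_{j+1} pr(A)` for all `j ∈ {1,…,n−1}` (with `pr(0) = 0`). -/
theorem stmt16 (n i m : ℕ) (hi : 2 ≤ i) (hin : i ≤ n) (j : ℕ)
    (hj1 : 1 ≤ j) (hjn : j ≤ n - 1) (A : Arr) (hA : InB n i m A) :
    Option.map (prMap n i m) (eop n i m j A) = eop n i m (j + 1) (prMap n i m A) := by
  have h := hA.isLastPassage hi hin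
  generalize lastPassage n i m A = L at h
  rcases lt_trichotomy j i with hj | rfl | hj
  · rcases Nat.lt_or_eq_of_le (Nat.succ_le_of_lt hj) with hj' | hj'
    · obtain ⟨q', hq', he⟩ := eop_col n i m (j + 1) hin hj' (prMap n i m A)
      rw [he]
      refine h.map_prMap_col j hj1 hj _ (fun r h1 h2 => ?_) q' hq' (fun p r => ?_)
      · rw [h.prMap_eq, if_pos ⟨by omega, by omega, h1, h2⟩, min_comm]
        rfl
      · simp only [upd]
        grind
    · subst hj'
      exact h.map_prMap_last_col j hj1 rfl
  · exact h.map_prMap_first_row (by omega)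
  · obtain ⟨q, hq, he⟩ := eop_row n i m j (by omega) hj A
    rw [he]
    refine h.map_prMap_row j hj.le (by omega) _ (fun p h1 h2 => ?_)
      (fun p h1 h2 => h.nonneg p (j - 1) h1 h2 (by omega) (by omega)) q hq (fun p r => ?_)
    · have := h.rec_eq p (j - 1) h1 h2 (by omega) (by omega)
      rw [Nat.sub_add_cancel (by omega)] at this
      rw [this]
      split_ifs with hp
      · rw [hp, h.right _ (by omega)]
      · rfl
    · simp only [upd]
      grind

end KR
end
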